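/- arXiv:1005.2987 — 2 statements merged into one kernel-verified Lean document; each statement's English description precedes it below -/
import Mathlib

section
/- (Corach–Larotonda) Let A be a unital complex Banach algebra and let k ≥ 0. The map π_k(GL_n(A)) → π_k(GL_{n+1}(A)) induced by the embedding g ↦ diag(g,1) is surjective for every n ≥ bsr A + k, and injective for every n ≥ bsr A + k + 1. Here π_k denotes the k-th homotopy group (set, for k = 0) based at the identity matrix. -/
/-- The set of unimodular `n`-tuples: tuples `(a₁, …, aₙ)` with `A·a₁ + ⋯ + A·aₙ = A`. -/
def Lg (A : Type*) [Ring A] (n : ℕ) : Set (Fin n → A) :=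
  {a | ∃ x : Fin n → A, ∑ i, x i * a i = 1}

/-- The Bass stable rank: the least `n ≥ 1` such that every unimodular `(n+1)`-tuple is
reducible to a unimodular `n`-tuple. -/
noncomputable def bsr (A : Type*) [Ring A] : ℕ∞ :=
  sInf {c : ℕ∞ | ∃ n : ℕ, c = n ∧ 1 ≤ n ∧
    ∀ a ∈ Lg A (n + 1), ∃ x : Fin n → A,
      (fun i : Fin n => a i.castSucc + x i * a (Fin.last n)) ∈ Lg A n}

/-- `GL_n(A)`: the group of invertible `n × n` matrices over `A`, topologized as a
subspace of `M_n(A)`. -/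
abbrev GLn (A : Type*) [Ring A] [TopologicalSpace A] (n : ℕ) : Type _ :=
  {M : Matrix (Fin n) (Fin n) A // IsUnit M}

/-- `diag(·, 1)`, as a multiplicative monoid homomorphism `M_n(A) → M_{n+1}(A)`. -/
def diagOneHom (A : Type*) [Ring A] (n : ℕ) :
    Matrix (Fin n) (Fin n) A →* Matrix (Fin (n + 1)) (Fin (n + 1)) A where
  toFun M := (Matrix.fromBlocks M 0 0 (1 : Matrix (Fin 1) (Fin 1) A)).submatrix
      finSumFinEquiv.symm finSumFinEquiv.symm
  map_one' := by
    show (Matrix.fromBlocks (1 : Matrix (Fin n) (Fin n) A) 0 0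
        (1 : Matrix (Fin 1) (Fin 1) A)).submatrix _ _ = 1
    rw [Matrix.fromBlocks_one, Matrix.submatrix_one_equiv]
  map_mul' M N := by
    rw [Matrix.submatrix_mul_equiv _ _ _ finSumFinEquiv.symm _, Matrix.fromBlocks_multiply]
    simp

lemma continuous_diagOneHom (A : Type*) [Ring A] [TopologicalSpace A] (n : ℕ) :
    Continuous (diagOneHom A n) := by
  apply continuous_pi; intro i; apply continuous_pi; intro j
  show Continuous fun M : Matrix (Fin n) (Fin n) A =>
    Matrix.fromBlocks M 0 0 (1 : Matrix (Fin 1) (Fin 1) A)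
      (finSumFinEquiv.symm i) (finSumFinEquiv.symm j)
  rcases finSumFinEquiv.symm i with a | a <;> rcases finSumFinEquiv.symm j with b | b <;> simp <;>
    first
      | exact (continuous_apply b).comp (continuous_apply a)
      | exact continuous_const

/-- The embedding `GL_n(A) → GL_{n+1}(A)`, `g ↦ diag(g, 1)`. -/
def glSucc (A : Type*) [Ring A] [TopologicalSpace A] (n : ℕ) : GLn A n → GLn A (n + 1) :=
  fun u => ⟨diagOneHom A n u.1, u.2.map (diagOneHom A n)⟩

lemma continuous_glSucc (A : Type*) [Ring A] [TopologicalSpace A] (n : ℕ) :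
    Continuous (glSucc A n) :=
  ((continuous_diagOneHom A n).comp continuous_subtype_val).subtype_mk _

lemma glSucc_one (A : Type*) [Ring A] [TopologicalSpace A] (n : ℕ) :
    glSucc A n ⟨1, isUnit_one⟩ = ⟨1, isUnit_one⟩ := by
  simp [glSucc]

/-- The map induced on homotopy groups by a continuous pointed map. -/
noncomputable def piMap (N : Type*) {X Y : Type*} [TopologicalSpace X] [TopologicalSpace Y]
    (f : C(X, Y)) {x : X} {y : Y} (hf : f x = y) :
    HomotopyGroup N X x → HomotopyGroup N Y y :=
  Quotient.map
    (fun p => ⟨f.comp p.1, fun t ht => by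
      rw [ContinuousMap.comp_apply, p.2 t ht, hf]⟩)
    (fun p q h => h.map (fun H => H.compContinuousMap f))

/-! ### Stable range, algebraic part -/

/-- The stable range condition for a fixed `n`. -/
def SRk (A : Type*) [Ring A] (n : ℕ) : Prop :=
  ∀ a ∈ Lg A (n + 1), ∃ x : Fin n → A,
      (fun i : Fin n => a i.castSucc + x i * a (Fin.last n)) ∈ Lg A n

lemma SRk.succ {A : Type*} [Ring A] {n : ℕ} (h : SRk A n) : SRk A (n + 1) := by
  intro a ha
  obtain ⟨p, hp⟩ := ha
  rw [Fin.sum_univ_castSucc, Fin.sum_univ_castSucc] at hp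
  have h1 : (Fin.snoc (fun i : Fin n => a i.castSucc.castSucc)
      (p (Fin.last n).castSucc * a (Fin.last n).castSucc
        + p (Fin.last (n+1)) * a (Fin.last (n+1))) : Fin (n+1) → A) ∈ Lg A (n+1) := by
    refine ⟨Fin.snoc (fun i : Fin n => p i.castSucc.castSucc) 1, ?_⟩
    rw [Fin.sum_univ_castSucc]
    simp only [Fin.snoc_castSucc, Fin.snoc_last, one_mul]
    rw [← add_assoc]; exact hp
  obtain ⟨w, q, hq⟩ := h _ h1
  simp only [Fin.snoc_castSucc, Fin.snoc_last] at hq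
  refine ⟨Fin.snoc (fun i => w i * p (Fin.last (n+1))) 0,
    Fin.snoc q (∑ i, q i * (w i * p (Fin.last n).castSucc)), ?_⟩
  rw [Fin.sum_univ_castSucc]
  simp only [Fin.snoc_castSucc, Fin.snoc_last, zero_mul, add_zero]
  rw [← hq, Finset.sum_mul, ← Finset.sum_add_distrib]
  refine Finset.sum_congr rfl fun i _ => ?_
  noncomm_ring

lemma SRk.mono {A : Type*} [Ring A] {m n : ℕ} (h : SRk A m) (hmn : m ≤ n) : SRk A n := by
  induction hmn with
  | refl => exact h
  | step _ ih => exact ih.succ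

lemma SRk.reduce {A : Type*} [Ring A] {n : ℕ} (h : SRk A n) {u : Fin (n + 1) → A}
    (hu : u ∈ Lg A (n + 1)) (i0 : Fin (n + 1)) :
    ∃ x q : Fin (n + 1) → A, x i0 = 0 ∧ q i0 = 0 ∧ ∑ i, q i * (u i + x i * u i0) = 1 := by
  obtain ⟨p, hp⟩ := hu
  set σ := Equiv.swap i0 (Fin.last n)
  have h1 : u ∘ σ ∈ Lg A (n + 1) := ⟨p ∘ σ, by
    rw [← hp]; exact Equiv.sum_comp σ (fun i => p i * u i)⟩
  obtain ⟨x, q, hq⟩ := h _ h1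
  refine ⟨fun i => (Fin.snoc x 0 : Fin (n+1) → A) (σ i),
    fun i => (Fin.snoc q 0 : Fin (n+1) → A) (σ i), ?_, ?_, ?_⟩
  · simp [σ]
  · simp [σ]
  · rw [← Equiv.sum_comp σ, Fin.sum_univ_castSucc]
    have hs : ∀ i, σ (σ i) = i := fun i => Equiv.swap_apply_self _ _ i
    have hl : σ (Fin.last n) = i0 := Equiv.swap_apply_right _ _
    simp only [hs, Fin.snoc_last, zero_mul, add_zero, Fin.snoc_castSucc]
    simpa [hl] using hq

lemma key_alg {B R : Type*} [Ring B] [Ring R] (φ : B →+* R) {n : ℕ} (hn : 1 ≤ n)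
    (h : SRk B n) {u : Fin (n + 1) → B} (hu : u ∈ Lg B (n + 1))
    (hφ : ∀ i, φ (u i) = if i = Fin.last n then 1 else 0) :
    ∃ v₁ v₂ v₃ r₁ r₂ r₃ : Fin (n + 1) → B,
      (∀ i, φ (v₁ i) = 0) ∧ (∀ i, φ (v₂ i) = 0) ∧ (∀ i, φ (v₃ i) = 0) ∧
      ∑ i, r₁ i * v₁ i = 0 ∧ ∑ i, r₂ i * v₂ i = 0 ∧ ∑ i, r₃ i * v₃ i = 0 ∧
      ∃ u₁ u₂ : Fin (n + 1) → B, (∀ i, u i + v₁ i * ∑ j, r₁ j * u j = u₁ i) ∧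
        (∀ i, u₁ i + v₂ i * ∑ j, r₂ j * u₁ j = u₂ i) ∧
        (∀ i, u₂ i + v₃ i * ∑ j, r₃ j * u₂ j = if i = Fin.last n then 1 else 0) := by
  have h0 : (0 : Fin (n+1)) ≠ Fin.last n := by
    intro h; have := congrArg Fin.val h; simp at this; omega
  obtain ⟨p, hp⟩ := hu
  have hu' : Function.update u 0 (u 0 * p 0 * u 0) ∈ Lg B (n+1) := by
    refine ⟨Function.update (fun i => (1 + p 0 * u 0) * p i) 0 (p 0), ?_⟩
    rw [Fin.sum_univ_succ] at hp ⊢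
    simp only [Function.update_self, ne_eq, Fin.succ_ne_zero, not_false_eq_true,
      Function.update_of_ne, mul_assoc]
    rw [← Finset.mul_sum, eq_sub_of_add_eq' hp]
    noncomm_ring
  obtain ⟨x, q, hx0, hq0, hq⟩ := h.reduce hu' 0
  simp only [Function.update_self] at hq
  set u₁ : Fin (n+1) → B := fun i => u i + x i * (u 0 * p 0 * u 0) with hu₁
  have hqu : ∑ i, q i * u₁ i = 1 := by
    rw [← hq]
    refine Finset.sum_congr rfl fun i _ => ?_
    by_cases hi : i = 0
    · subst hi; simp [hq0]
    · simp [hu₁, hi]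
  have hφ0 : φ (u 0) = 0 := by rw [hφ, if_neg h0]
  have hφ1 : ∀ i, φ (u₁ i) = if i = Fin.last n then 1 else 0 := fun i => by
    simp [hu₁, hφ0, hφ]
  set γ : B := u₁ (Fin.last n) - 1 with hγ
  set u₂ : Fin (n+1) → B := fun i => u₁ i + (if i = 0 then γ - u 0 else 0) with hu₂
  have hu₁0 : u₁ 0 = u 0 := by simp [hu₁, hx0]
  have hu₂0 : u₂ 0 = γ := by simp [hu₂, hu₁0]
  have hu₂l : u₂ (Fin.last n) = 1 + γ := by simp [hu₂, h0.symm, hγ]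
  have hφγ : φ γ = 0 := by simp [hγ, hφ1]
  have hφ2 : ∀ i, φ (u₂ i) = if i = Fin.last n then 1 else 0 := fun i => by
    simp only [hu₂, map_add, hφ1]
    split_ifs <;> simp [hφγ, hφ0]
  have hr3 : ∀ z : Fin (n+1) → B, ∑ j, (if j = Fin.last n then 1 else if j = 0 then -1 else 0) * z j
      = z (Fin.last n) - z 0 := by
    intro z
    have : ∀ j, (if j = Fin.last n then (1 : B) else if j = 0 then -1 else 0) * z j
        = (if j = Fin.last n then z j else 0) - (if j = 0 then z j else 0) := by
      intro j
      by_cases h1 : j = Fin.last n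
      · subst h1; simp [h0.symm]
      · by_cases h2 : j = 0 <;> simp [h1, h2, h0]
    simp [this, Finset.sum_sub_distrib]
  refine ⟨fun i => x i * (u 0 * p 0), fun i => if i = 0 then γ - u 0 else 0,
    fun i => (if i = Fin.last n then 1 else 0) - u₂ i, fun i => if i = 0 then 1 else 0, q,
    fun j => if j = Fin.last n then 1 else if j = 0 then -1 else 0, ?_, ?_, ?_, ?_, ?_, ?_,
    u₁, u₂, ?_, ?_, ?_⟩
  · intro i; simp [hφ0]
  · intro i; dsimp only; split_ifs <;> simp [hφ0, hφγ]
  · intro i; simp only [map_sub, hφ2]; split_ifs <;> simp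
  · simp [hx0]
  · simp [hq0]
  · rw [hr3, hu₂0, hu₂l]; simp [h0]
  · intro i; simp [hu₁, mul_assoc]
  · intro i; rw [hqu]; simp [hu₂]
  · intro i; rw [hr3, hu₂0, hu₂l]; simp

/-! ### Transvections -/

/-- `1 + v r` for a column `v` and a row `r`. -/
def tv {A : Type*} [Ring A] {m : ℕ} (v r : Fin m → A) : Matrix (Fin m) (Fin m) A :=
  1 + Matrix.vecMulVec v r

lemma tv_mulVec {A : Type*} [Ring A] {m : ℕ} (v r u : Fin m → A) (i : Fin m) :
    (tv v r).mulVec u i = u i + v i * ∑ j, r j * u j := by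
  rw [tv, Matrix.add_mulVec, Matrix.one_mulVec, Pi.add_apply]
  simp only [Matrix.mulVec, dotProduct, Matrix.vecMulVec_apply, Finset.mul_sum, mul_assoc]

lemma isUnit_tv {A : Type*} [Ring A] {m : ℕ} (v r : Fin m → A) (h : ∑ j, r j * v j = 0) :
    IsUnit (tv v r) := by
  have h2 : Matrix.vecMulVec v r * Matrix.vecMulVec v r = 0 := by
    ext i j
    simp only [Matrix.mul_apply, Matrix.vecMulVec_apply, Matrix.zero_apply]
    have : ∀ x, v i * r x * (v x * r j) = v i * (r x * v x) * r j := fun x => by noncomm_ring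
    simp only [this]
    rw [← Finset.sum_mul, ← Finset.mul_sum, h]; simp
  refine ⟨⟨1 + Matrix.vecMulVec v r, 1 - Matrix.vecMulVec v r, ?_, ?_⟩, rfl⟩
  · rw [add_mul, one_mul, mul_sub, h2]; simp
  · rw [sub_mul, one_mul, mul_add, h2]; simp

lemma Lg_mulVec {A : Type*} [Ring A] {m : ℕ} {g : Matrix (Fin m) (Fin m) A} (hg : IsUnit g)
    {u : Fin m → A} (hu : u ∈ Lg A m) : g.mulVec u ∈ Lg A m := by
  obtain ⟨p, hp⟩ := hu
  obtain ⟨g, rfl⟩ := hg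
  refine ⟨Matrix.vecMul p (↑g⁻¹ : Matrix (Fin m) (Fin m) A), ?_⟩
  change Matrix.vecMul p _ ⬝ᵥ _ = 1
  rw [Matrix.dotProduct_mulVec, Matrix.vecMul_vecMul, Units.inv_mul, Matrix.vecMul_one]
  exact hp

/-- The last standard basis vector. -/
def eL (A : Type*) [Ring A] (n : ℕ) : Fin (n + 1) → A := fun i => if i = Fin.last n then 1 else 0

lemma exists_unit_mulVec {B : Type*} [Ring B] {n : ℕ} (hn : 1 ≤ n)
    (h : SRk B n) {u : Fin (n + 1) → B} (hu : u ∈ Lg B (n + 1)) :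
    ∃ g : Matrix (Fin (n + 1)) (Fin (n + 1)) B, IsUnit g ∧ g.mulVec u = eL B n := by
  obtain ⟨v₁, v₂, v₃, r₁, r₂, r₃, -, -, -, h1, h2, h3, u₁, u₂, e1, e2, e3⟩ :=
    key_alg (R := PUnit.{1}) (⟨⟨⟨fun _ => PUnit.unit, rfl⟩, fun _ _ => rfl⟩, rfl, fun _ _ => rfl⟩) hn h hu (fun i => Subsingleton.elim _ _)
  refine ⟨tv v₃ r₃ * (tv v₂ r₂ * tv v₁ r₁),
    (isUnit_tv _ _ h3).mul ((isUnit_tv _ _ h2).mul (isUnit_tv _ _ h1)), ?_⟩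
  rw [← Matrix.mulVec_mulVec, ← Matrix.mulVec_mulVec]
  have e1' : (tv v₁ r₁).mulVec u = u₁ := by ext i; rw [tv_mulVec, e1]
  have e2' : (tv v₂ r₂).mulVec u₁ = u₂ := by ext i; rw [tv_mulVec, e2]
  have e3' : (tv v₃ r₃).mulVec u₂ = eL B n := by ext i; rw [tv_mulVec, e3]; rfl
  rw [e1', e2', e3']

/-! ### Path connectedness of the set of reductions -/

lemma joinedIn_of_line {E : Type*} [NormedAddCommGroup E] [NormedSpace ℝ E] {S : Set E} {y d : E}
    (h : ∀ t : ℝ, y + t • d ∈ S) : JoinedIn S y (y + d) := by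
  refine ⟨⟨⟨fun t => y + (t : ℝ) • d, by fun_prop⟩, by simp, by simp⟩, fun t => h t⟩

lemma joined_eL {A : Type*} [NormedRing A] [NormedAlgebra ℝ A] {n : ℕ} (hn : 1 ≤ n)
    (h : SRk A n) (b : A) (y : Fin (n + 1) → A)
    (hy : (fun i => eL A n i + y i * b) ∈ Lg A (n + 1)) :
    JoinedIn {y : Fin (n + 1) → A | (fun i => eL A n i + y i * b) ∈ Lg A (n + 1)} y 0 := by
  have h0 : (0 : Fin (n+1)) ≠ Fin.last n := by
    intro h; have := congrArg Fin.val h; simp at this; omega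
  have he0 : eL A n 0 = 0 := by simp [eL, h0]
  obtain ⟨w, q, hw0, hq0, hq⟩ := h.reduce hy 0
  rw [he0] at hq
  have s1 : JoinedIn {y : Fin (n + 1) → A | (fun i => eL A n i + y i * b) ∈ Lg A (n + 1)} y
      (y + fun i => w i * y 0) := by
    apply joinedIn_of_line
    intro t
    have := Lg_mulVec (isUnit_tv (fun i => t • w i) (fun i => if i = 0 then 1 else 0)
      (by simp [hw0])) hy
    refine (congrArg (· ∈ Lg A (n+1)) ?_).mp this
    ext i
    rw [tv_mulVec]
    simp [he0, add_mul, add_assoc, mul_assoc]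
  set y₁ : Fin (n+1) → A := y + fun i => w i * y 0 with hy₁
  have hqy : ∑ i, q i * (eL A n i + y₁ i * b) = 1 := by
    rw [← hq]
    refine Finset.sum_congr rfl fun i _ => ?_
    simp only [hy₁, Pi.add_apply]
    noncomm_ring
  have s2 : JoinedIn {y : Fin (n + 1) → A | (fun i => eL A n i + y i * b) ∈ Lg A (n + 1)} y₁
      (y₁ + fun i => if i = 0 then y₁ (Fin.last n) - y₁ 0 else 0) := by
    apply joinedIn_of_line
    intro t
    refine ⟨q, ?_⟩
    rw [← hqy]
    refine Finset.sum_congr rfl fun i _ => ?_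
    by_cases hi : i = 0
    · subst hi; simp [hq0]
    · simp [hi]
  set y₂ : Fin (n+1) → A := (y₁ + fun i => if i = 0 then y₁ (Fin.last n) - y₁ 0 else 0) with hy₂
  have hy₂' : y₂ 0 = y₂ (Fin.last n) := by simp [hy₂, h0.symm]
  have s3 : JoinedIn {y : Fin (n + 1) → A | (fun i => eL A n i + y i * b) ∈ Lg A (n + 1)} y₂
      (y₂ + -y₂) := by
    apply joinedIn_of_line
    intro t
    refine ⟨fun i => if i = Fin.last n then 1 else if i = 0 then -1 else 0, ?_⟩
    have : ∀ z : Fin (n+1) → A, ∑ j, (if j = Fin.last n then 1 else if j = 0 then -1 else 0) * z j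
      = z (Fin.last n) - z 0 := by
      intro z
      have : ∀ j, (if j = Fin.last n then (1 : A) else if j = 0 then -1 else 0) * z j
          = (if j = Fin.last n then z j else 0) - (if j = 0 then z j else 0) := by
        intro j
        by_cases h1 : j = Fin.last n
        · subst h1; simp [h0.symm]
        · by_cases h2 : j = 0 <;> simp [h1, h2, h0]
      simp [this, Finset.sum_sub_distrib]
    rw [this, he0]
    simp [hy₂', eL]
  rw [add_neg_cancel] at s3
  exact (s1.trans s2).trans s3

lemma joined_reductions {A : Type*} [NormedRing A] [NormedAlgebra ℝ A] {n : ℕ} (hn : 1 ≤ n)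
    (h : SRk A n) (a : Fin (n + 1) → A) (b : A) (x x' : Fin (n + 1) → A)
    (hx : (fun i => a i + x i * b) ∈ Lg A (n + 1))
    (hx' : (fun i => a i + x' i * b) ∈ Lg A (n + 1)) :
    JoinedIn {y : Fin (n + 1) → A | (fun i => a i + y i * b) ∈ Lg A (n + 1)} x' x := by
  obtain ⟨g, ⟨g, rfl⟩, hgu⟩ := exists_unit_mulVec hn h hx
  have hmul : ∀ (M : Matrix (Fin (n+1)) (Fin (n+1)) A) (z : Fin (n+1) → A),
      M.mulVec (fun i => z i * b) = fun i => M.mulVec z i * b := by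
    intro M z; ext i
    simp only [Matrix.mulVec, dotProduct, Finset.sum_mul, mul_assoc]
  have key : ∀ z : Fin (n+1) → A, (fun i => eL A n i + z i * b) =
      (g : Matrix (Fin (n+1)) (Fin (n+1)) A).mulVec
        (fun i => a i + (x + (↑g⁻¹ : Matrix (Fin (n+1)) (Fin (n+1)) A).mulVec z) i * b) := by
    intro z
    have : (fun i => a i + (x + (↑g⁻¹ : Matrix (Fin (n+1)) (Fin (n+1)) A).mulVec z) i * b)
        = (fun i => a i + x i * b) + (↑g⁻¹ : Matrix (Fin (n+1)) (Fin (n+1)) A).mulVec (fun i => z i * b) := by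
      rw [hmul]; ext i; simp [add_mul, add_assoc]
    rw [this, Matrix.mulVec_add, hgu, Matrix.mulVec_mulVec, Units.mul_inv, Matrix.one_mulVec]
    rfl
  have key2 : ∀ z : Fin (n+1) → A, (fun i => eL A n i + z i * b) ∈ Lg A (n+1) →
      (fun i => a i + (x + (↑g⁻¹ : Matrix (Fin (n+1)) (Fin (n+1)) A).mulVec z) i * b) ∈ Lg A (n+1) := by
    intro z hz
    have := Lg_mulVec (g⁻¹).isUnit hz
    rwa [key, Matrix.mulVec_mulVec, Units.inv_mul, Matrix.one_mulVec] at this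
  have hz : (fun i => eL A n i + (g : Matrix (Fin (n+1)) (Fin (n+1)) A).mulVec (x' - x) i * b) ∈ Lg A (n+1) := by
    rw [key]
    apply Lg_mulVec g.isUnit
    rw [Matrix.mulVec_mulVec, Units.inv_mul, Matrix.one_mulVec]
    simpa using hx'
  obtain ⟨γ, hγ⟩ := joined_eL hn h b _ hz
  have hc : Continuous fun z : Fin (n+1) → A => x + (↑g⁻¹ : Matrix (Fin (n+1)) (Fin (n+1)) A).mulVec z := by
    apply continuous_const.add
    exact Continuous.matrix_mulVec continuous_const continuous_id
  refine ⟨(γ.map hc).cast ?_ ?_, fun t => key2 _ (hγ t)⟩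
  · rw [Matrix.mulVec_mulVec, Units.inv_mul, Matrix.one_mulVec]; simp
  · simp

/-! ### Sections over the real line -/

lemma exists_section {E : Type*} [NormedAddCommGroup E] [NormedSpace ℝ E] (U : Set (ℝ × E))
    (hU : IsOpen U) (hne : ∀ t, ∃ x, (t, x) ∈ U)
    (hj : ∀ t x y, (t, x) ∈ U → (t, y) ∈ U → JoinedIn {z | (t, z) ∈ U} x y) (T : ℝ) :
    ∃ f : ℝ → E, Continuous f ∧ ∀ s ∈ Set.Icc 0 T, (s, f s) ∈ U := by
  set S : Set ℝ := {T | ∃ f : ℝ → E, Continuous f ∧ ∀ s ∈ Set.Icc 0 T, (s, f s) ∈ U} with hS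
  have hdown : ∀ s t, s ≤ t → t ∈ S → s ∈ S := by
    rintro s t hst ⟨f, hf, h⟩
    exact ⟨f, hf, fun r hr => h r ⟨hr.1, hr.2.trans hst⟩⟩
  have hloc : ∀ τ : ℝ, ∃ ε > 0, ∀ s ∈ Metric.ball τ ε, ∀ t ∈ Metric.ball τ ε, s ∈ S → t ∈ S := by
    intro τ
    obtain ⟨c, hc⟩ := hne τ
    have : {t : ℝ | (t, c) ∈ U} ∈ nhds τ :=
      (hU.preimage (by fun_prop : Continuous fun t : ℝ => (t, c))).mem_nhds hc
    obtain ⟨ε, hε, hball⟩ := Metric.mem_nhds_iff.mp this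
    refine ⟨ε, hε, fun s hs t ht hsS => ?_⟩
    rcases le_total t s with hts | hst
    · exact hdown _ _ hts hsS
    rcases lt_or_ge s 0 with hs0 | hs0
    · -- the constant section does it
      refine ⟨fun _ => c, continuous_const, fun r hr => hball ?_⟩
      rw [Real.ball_eq_Ioo] at hs ht ⊢
      exact ⟨by linarith [hs.1, hr.1], by linarith [ht.2, hr.2]⟩
    obtain ⟨f, hf, h⟩ := hsS
    have hfs : (s, f s) ∈ U := h s ⟨hs0, le_rfl⟩
    obtain ⟨γ, hγ⟩ := hj s (f s) c hfs (hball hs)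
    -- tube
    have htube : ∀ᶠ r in nhds s, ∀ k : unitInterval, (r, γ k) ∈ U := by
      have := (isCompact_univ (X := unitInterval)).eventually_forall_of_forall_eventually
        (x₀ := s) (P := fun r k => (r, γ k) ∈ U) (fun k _ => by
          have hc : Continuous fun z : ℝ × unitInterval => (z.1, γ z.2) := by fun_prop
          exact (hU.preimage hc).mem_nhds (hγ k))
      simpa using this
    obtain ⟨δ, hδ, hd⟩ := Metric.eventually_nhds_iff.mp htube
    have hδ2 : 0 < δ / 2 := by linarith
    refine ⟨fun r => f (min r s) + (γ.extend ((r - s) / (δ/2)) - f s), ?_, ?_⟩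
    · have : Continuous γ.extend := γ.continuous_extend
      fun_prop
    · intro r hr
      rcases le_total r s with hrs | hsr
      · dsimp only
        rw [min_eq_left hrs, γ.extend_of_le_zero (div_nonpos_of_nonpos_of_nonneg (by linarith) hδ2.le)]
        simpa using h r ⟨hr.1, hrs⟩
      · dsimp only
        rw [min_eq_right hsr, add_sub_cancel]
        rcases le_total (r - s) (δ/2) with h1 | h1
        · rw [γ.extend_apply ⟨div_nonneg (by linarith) hδ2.le, (div_le_one hδ2).mpr h1⟩]
          apply hd
          rw [Real.dist_eq, abs_of_nonneg (by linarith)]; linarith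
        · rw [γ.extend_of_one_le ((one_le_div hδ2).mpr h1)]
          apply hball
          rw [Real.ball_eq_Ioo] at hs ht ⊢
          exact ⟨by linarith [hs.1, hr.1], by linarith [ht.2, hr.2]⟩
  have hclopen : IsClopen S := by
    refine ⟨⟨?_⟩, ?_⟩
    · rw [Metric.isOpen_iff]
      intro τ hτ
      obtain ⟨ε, hε, h⟩ := hloc τ
      exact ⟨ε, hε, fun s hs hsS => hτ (h s hs τ (Metric.mem_ball_self hε) hsS)⟩
    · rw [Metric.isOpen_iff]
      intro τ hτ
      obtain ⟨ε, hε, h⟩ := hloc τ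
      exact ⟨ε, hε, fun s hs => h τ (Metric.mem_ball_self hε) s hs hτ⟩
  have hne : S.Nonempty := ⟨-1, fun _ => 0, continuous_const, fun s hs => by
    exfalso; linarith [hs.1, hs.2]⟩
  have := hclopen.eq_univ hne
  exact (this ▸ Set.mem_univ T : T ∈ S)

/-! ### Stable range of algebras of continuous functions -/

lemma isOpen_Lg (A : Type*) [NormedRing A] [CompleteSpace A] (n : ℕ) : IsOpen (Lg A n) := by
  rw [isOpen_iff_mem_nhds]
  rintro a ⟨p, hp⟩
  have hc : Continuous fun a : Fin n → A => ∑ i, p i * a i := by fun_prop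
  have : {a : Fin n → A | IsUnit (∑ i, p i * a i)} ∈ nhds a :=
    (Units.isOpen.preimage hc).mem_nhds ⟨1, hp.symm⟩
  refine Filter.mem_of_superset this ?_
  rintro a' ⟨g, hg⟩
  refine ⟨fun i => ↑g⁻¹ * p i, ?_⟩
  simp only [mul_assoc]
  rw [← Finset.mul_sum, ← hg, Units.inv_mul]

lemma Lg_of_pointwise {X A : Type*} [TopologicalSpace X] [CompactSpace X] [T2Space X]
    [NormedRing A] [NormedAlgebra ℝ A] [CompleteSpace A] {n : ℕ} (a : Fin n → C(X, A))
    (h : ∀ x, (fun i => a i x) ∈ Lg A n) : a ∈ Lg C(X, A) n := by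
  obtain ⟨g, hg⟩ := exists_continuous_forall_mem_convex_of_local (X := X) (E := Fin n → A)
    (t := fun x => {p | ∑ i, p i * a i x = 1}) (fun x => by
      intro p hp q hq s t _ _ hst
      simp only [Set.mem_ofPred_eq] at hp hq ⊢
      simp only [Pi.add_apply, Pi.smul_apply, add_mul, smul_mul_assoc, Finset.sum_add_distrib,
        ← Finset.smul_sum, hp, hq]
      rw [← add_smul, hst, one_smul]) (fun x => by
      obtain ⟨p, hp⟩ := h x
      have hc : Continuous fun y : X => ∑ i, p i * a i y := by fun_prop
      refine ⟨{y | IsUnit (∑ i, p i * a i y)}, (Units.isOpen.preimage hc).mem_nhds ⟨1, hp.symm⟩, fun y i => Ring.inverse (∑ i, p i * a i y) * p i, ?_, ?_⟩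
      · rw [continuousOn_pi]
        intro i
        refine ContinuousOn.mul ?_ continuousOn_const
        rintro y ⟨g, hg⟩
        have h1 := NormedRing.inverse_continuousAt g
        rw [hg] at h1
        exact (ContinuousAt.comp (f := fun y : X => ∑ i, p i * a i y) h1
          hc.continuousAt).continuousWithinAt
      · intro y hy
        simp only [Set.mem_ofPred_eq, mul_assoc]
        rw [← Finset.mul_sum]
        exact Ring.inverse_mul_cancel _ hy)
  refine ⟨fun i => ⟨fun x => g x i, by fun_prop⟩, ?_⟩
  ext x
  simpa using hg x

lemma pointwise_of_Lg {X A : Type*} [TopologicalSpace X]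
    [NormedRing A] {n : ℕ} {a : Fin n → C(X, A)}
    (h : a ∈ Lg C(X, A) n) (x : X) : (fun i => a i x) ∈ Lg A n := by
  obtain ⟨p, hp⟩ := h
  refine ⟨fun i => p i x, ?_⟩
  simpa using congrArg (fun f : C(X, A) => f x) hp

lemma SRk.interval_step {A : Type*} [NormedRing A] [NormedAlgebra ℝ A] [CompleteSpace A] {n : ℕ}
    (hn : 1 ≤ n) (h : SRk A n) : SRk C(unitInterval, A) (n + 1) := by
  intro a ha
  set pr : ℝ → unitInterval := Set.projIcc 0 1 zero_le_one with hpr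
  have hprc : Continuous pr := continuous_projIcc
  set F : ℝ × (Fin (n+1) → A) → (Fin (n+1) → A) :=
    fun z i => a i.castSucc (pr z.1) + z.2 i * a (Fin.last (n+1)) (pr z.1) with hF
  have hFc : Continuous F := by
    rw [hF]; fun_prop
  obtain ⟨f, hf, hfU⟩ := exists_section (F ⁻¹' Lg A (n+1)) ((isOpen_Lg A (n+1)).preimage hFc)
    (fun t => by
      obtain ⟨x, hx⟩ := h.succ _ (pointwise_of_Lg ha (pr t))
      exact ⟨x, hx⟩)
    (fun t x y hx hy => joined_reductions hn h _ _ y x hy hx) 1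
  refine ⟨fun i => ⟨fun t => f t i, by fun_prop⟩, Lg_of_pointwise _ fun t => ?_⟩
  have := hfU t t.2
  have ht : pr (t : ℝ) = t := Set.projIcc_val zero_le_one t
  simp only [Set.mem_preimage, hF, ht] at this
  exact this

lemma SRk.retract {B B' : Type*} [Ring B] [Ring B'] {n : ℕ} (h : SRk B n) (φ : B →+* B')
    (ψ : B' →+* B) (hφψ : ∀ b, φ (ψ b) = b) : SRk B' n := by
  rintro a ⟨p, hp⟩
  obtain ⟨x, q, hq⟩ := h (fun i => ψ (a i)) ⟨fun i => ψ (p i), by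
    simpa using congrArg ψ hp⟩
  refine ⟨fun i => φ (x i), fun i => φ (q i), ?_⟩
  simpa [hφψ] using congrArg φ hq

/-- Currying as a ring homomorphism. -/
def curryHom (X A : Type*) [TopologicalSpace X] [LocallyCompactSpace X] [NormedRing A] :
    C(unitInterval × X, A) →+* C(unitInterval, C(X, A)) where
  toFun f := f.curry
  map_one' := rfl
  map_zero' := rfl
  map_mul' _ _ := rfl
  map_add' _ _ := rfl

/-- Uncurrying as a ring homomorphism. -/
def uncurryHom (X A : Type*) [TopologicalSpace X] [LocallyCompactSpace X] [NormedRing A] :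
    C(unitInterval, C(X, A)) →+* C(unitInterval × X, A) where
  toFun f := f.uncurry
  map_one' := rfl
  map_zero' := rfl
  map_mul' _ _ := rfl
  map_add' _ _ := rfl

/-- Precomposition as a ring homomorphism. -/
def compHom {X Y : Type*} (A : Type*) [TopologicalSpace X] [TopologicalSpace Y] [NormedRing A]
    (f : C(X, Y)) : C(Y, A) →+* C(X, A) where
  toFun g := g.comp f
  map_one' := rfl
  map_zero' := rfl
  map_mul' _ _ := rfl
  map_add' _ _ := rfl

lemma SRk.prod {X A : Type*} [TopologicalSpace X] [CompactSpace X] [T2Space X]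
    [NormedRing A] [NormedAlgebra ℝ A] [CompleteSpace A] {n : ℕ}
    (hn : 1 ≤ n) (h : SRk C(X, A) n) : SRk C(unitInterval × X, A) (n + 1) :=
  (h.interval_step hn).retract (uncurryHom X A) (curryHom X A) (fun _ => rfl)

lemma SRk.cube {A : Type*} [NormedRing A] [NormedAlgebra ℝ A] [CompleteSpace A] {n : ℕ}
    (hn : 1 ≤ n) (h : SRk A n) (k : ℕ) : SRk C(Fin k → unitInterval, A) (n + k) := by
  induction k with
  | zero =>
    refine h.retract (⟨⟨⟨fun a => ContinuousMap.const _ a, rfl⟩, fun _ _ => rfl⟩, rfl,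
      fun _ _ => rfl⟩) (⟨⟨⟨fun f => f default, rfl⟩, fun _ _ => rfl⟩, rfl, fun _ _ => rfl⟩) ?_
    intro f
    ext x
    exact congrArg f (Subsingleton.elim _ _)
  | succ k ih =>
    refine (ih.prod (by omega)).retract
      (compHom A (⟨fun x => (x 0, fun i => x i.succ), by fun_prop⟩ :
        C(Fin (k+1) → unitInterval, unitInterval × (Fin k → unitInterval))))
      (compHom A (⟨fun x => Fin.cons x.1 x.2, by fun_prop⟩ :
        C(unitInterval × (Fin k → unitInterval), Fin (k+1) → unitInterval))) ?_
    intro f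
    ext x
    refine congrArg f ?_
    exact Fin.cons_self_tail x

lemma exists_SRk_of_bsr {A : Type*} [Ring A] {k n : ℕ} (h : bsr A + (k : ℕ∞) ≤ (n : ℕ∞)) :
    ∃ m, 1 ≤ m ∧ SRk A m ∧ m + k ≤ n := by
  set S : Set ℕ∞ := {c : ℕ∞ | ∃ n : ℕ, c = n ∧ 1 ≤ n ∧
    ∀ a ∈ Lg A (n + 1), ∃ x : Fin n → A,
      (fun i : Fin n => a i.castSucc + x i * a (Fin.last n)) ∈ Lg A n} with hS
  have hb : bsr A = sInf S := rfl
  have hne : S.Nonempty := by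
    by_contra hne
    rw [Set.not_nonempty_iff_eq_empty] at hne
    rw [hb, hne, sInf_empty, top_add] at h
    exact absurd h (by simp)
  obtain ⟨m, hm, h1, h2⟩ := csInf_mem hne
  refine ⟨m, h1, h2, ?_⟩
  rw [hb, hm] at h
  exact_mod_cast h

/-! ### The main deformation and the conclusion -/

lemma continuous_tv {Z A : Type*} [TopologicalSpace Z] [NormedRing A] {m : ℕ}
    {v r : Z → Fin m → A} (hv : Continuous v) (hr : Continuous r) :
    Continuous fun z => tv (v z) (r z) := by
  unfold tv
  exact continuous_const.add (Continuous.matrix_vecMulVec hv hr)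

lemma key_top {X A : Type*} [TopologicalSpace X] [CompactSpace X] [T2Space X]
    [NormedRing A] [NormedAlgebra ℝ A] [CompleteSpace A] {n : ℕ} (hn : 1 ≤ n)
    (h : SRk C(X, A) n) (Y : Set X) (f : X → Matrix (Fin (n + 1)) (Fin (n + 1)) A)
    (hf : Continuous f) (hu : ∀ x, IsUnit (f x))
    (hY : ∀ y ∈ Y, ∀ i, f y i (Fin.last n) = eL A n i) :
    ∃ E : unitInterval × X → Matrix (Fin (n + 1)) (Fin (n + 1)) A, Continuous E ∧
      (∀ z, IsUnit (E z)) ∧ (∀ x, E (0, x) = 1) ∧ (∀ t, ∀ y ∈ Y, E (t, y) = 1) ∧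
      ∀ x i, (E (1, x) * f x) i (Fin.last n) = eL A n i := by
  set u : Fin (n+1) → C(X, A) := fun i => ⟨fun x => f x i (Fin.last n),
    hf.matrix_elem i (Fin.last n)⟩ with hudef
  have huL : u ∈ Lg C(X, A) (n+1) := by
    apply Lg_of_pointwise
    intro x
    obtain ⟨g, hg⟩ := hu x
    refine ⟨fun i => (↑g⁻¹ : Matrix (Fin (n+1)) (Fin (n+1)) A) (Fin.last n) i, ?_⟩
    have := congrFun (congrFun g.inv_mul (Fin.last n)) (Fin.last n)
    rw [hg, Matrix.mul_apply, Matrix.one_apply_eq] at this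
    exact this
  let φ : C(X, A) →+* (Y → A) := ⟨⟨⟨fun g y => g y, rfl⟩, fun _ _ => rfl⟩, rfl, fun _ _ => rfl⟩
  obtain ⟨v₁, v₂, v₃, r₁, r₂, r₃, j1, j2, j3, h1, h2, h3, u₁, u₂, e1, e2, e3⟩ :=
    key_alg φ hn h huL (fun i => by
      ext y
      change f y i (Fin.last n) = _
      rw [hY y y.2 i, eL]
      split_ifs <;> rfl)
  have hφ : ∀ (v : Fin (n+1) → C(X, A)), (∀ i, φ (v i) = 0) → ∀ y ∈ Y, ∀ i, v i y = 0 :=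
    fun v hv y hy i => congrFun (hv i) ⟨y, hy⟩
  have hsum : ∀ (r v : Fin (n+1) → C(X, A)), ∑ i, r i * v i = 0 → ∀ (t : ℝ) (x : X),
      ∑ i, r i x * (t • v i x) = 0 := by
    intro r v hrv t x
    have := congrArg (fun g : C(X, A) => t • g x) hrv
    simpa [Finset.smul_sum] using this
  let W : (Fin (n+1) → C(X, A)) → (Fin (n+1) → C(X, A)) → unitInterval × X →
      Matrix (Fin (n + 1)) (Fin (n + 1)) A :=
    fun v r z => tv (fun i => (z.1 : ℝ) • v i z.2) (fun i => r i z.2)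
  have hWc : ∀ v r, Continuous (W v r) := fun v r =>
    continuous_tv (by fun_prop) (by fun_prop)
  have hWu : ∀ v r, ∑ i, r i * v i = 0 → ∀ z, IsUnit (W v r z) := fun v r hrv z =>
    isUnit_tv _ _ (hsum r v hrv _ _)
  have htv0 : ∀ (v r : Fin (n+1) → A), (∀ i, v i = 0) → tv v r = 1 := by
    intro v r hv
    ext i j
    simp [tv, Matrix.vecMulVec_apply, hv]
  have hW0 : ∀ v r x, W v r (0, x) = 1 := fun v r x => htv0 _ _ (by simp)
  have hWY : ∀ v r, (∀ i, φ (v i) = 0) → ∀ t, ∀ y ∈ Y, W v r (t, y) = 1 :=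
    fun v r hv t y hy => htv0 _ _ (fun i => by simp [hφ v hv y hy i])
  have hW1 : ∀ v r (a a' : Fin (n+1) → C(X, A)), (∀ i, a i + v i * ∑ j, r j * a j = a' i) →
      ∀ x, (W v r (1, x)).mulVec (fun i => a i x) = fun i => a' i x := by
    intro v r a a' haa x
    ext i
    simp only [W]
    rw [tv_mulVec]
    have := congrArg (fun g : C(X, A) => g x) (haa i)
    simpa using this
  refine ⟨fun z => W v₃ r₃ z * (W v₂ r₂ z * W v₁ r₁ z),
    (hWc _ _).matrix_mul ((hWc _ _).matrix_mul (hWc _ _)),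
    fun z => (hWu _ _ h3 z).mul ((hWu _ _ h2 z).mul (hWu _ _ h1 z)), ?_, ?_, ?_⟩
  · intro x; simp [hW0]
  · intro t y hy; simp [hWY _ _ j1 t y hy, hWY _ _ j2 t y hy, hWY _ _ j3 t y hy]
  · intro x i
    have : ∀ M : Matrix (Fin (n+1)) (Fin (n+1)) A, (M * f x) i (Fin.last n) =
        M.mulVec (fun j => u j x) i := fun M => rfl
    rw [this, ← Matrix.mulVec_mulVec, ← Matrix.mulVec_mulVec, hW1 v₁ r₁ u u₁ e1,
      hW1 v₂ r₂ u₁ u₂ e2, hW1 v₃ r₃ u₂ _ e3]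
    dsimp only [eL]
    split_ifs <;> rfl

lemma diagOneHom_cc {A : Type*} [Ring A] {n : ℕ} (h : Matrix (Fin n) (Fin n) A) (i j : Fin n) :
    diagOneHom A n h i.castSucc j.castSucc = h i j := by
  have : ∀ i : Fin n, finSumFinEquiv.symm (i.castSucc) = (Sum.inl i : Fin n ⊕ Fin 1) :=
    fun i => finSumFinEquiv_symm_apply_castAdd i
  simp [diagOneHom, this]

lemma diagOneHom_cl {A : Type*} [Ring A] {n : ℕ} (h : Matrix (Fin n) (Fin n) A) (i : Fin n) :
    diagOneHom A n h i.castSucc (Fin.last n) = 0 := by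
  have : ∀ i : Fin n, finSumFinEquiv.symm (i.castSucc) = (Sum.inl i : Fin n ⊕ Fin 1) :=
    fun i => finSumFinEquiv_symm_apply_castAdd i
  have h2 : finSumFinEquiv.symm (Fin.last n) = (Sum.inr 0 : Fin n ⊕ Fin 1) :=
    finSumFinEquiv_symm_apply_natAdd 0
  simp [diagOneHom, this, h2]

lemma diagOneHom_lc {A : Type*} [Ring A] {n : ℕ} (h : Matrix (Fin n) (Fin n) A) (i : Fin n) :
    diagOneHom A n h (Fin.last n) i.castSucc = 0 := by
  have : ∀ i : Fin n, finSumFinEquiv.symm (i.castSucc) = (Sum.inl i : Fin n ⊕ Fin 1) :=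
    fun i => finSumFinEquiv_symm_apply_castAdd i
  have h2 : finSumFinEquiv.symm (Fin.last n) = (Sum.inr 0 : Fin n ⊕ Fin 1) :=
    finSumFinEquiv_symm_apply_natAdd 0
  simp [diagOneHom, this, h2]

lemma diagOneHom_ll {A : Type*} [Ring A] {n : ℕ} (h : Matrix (Fin n) (Fin n) A) :
    diagOneHom A n h (Fin.last n) (Fin.last n) = 1 := by
  have h2 : finSumFinEquiv.symm (Fin.last n) = (Sum.inr 0 : Fin n ⊕ Fin 1) :=
    finSumFinEquiv_symm_apply_natAdd 0
  simp [diagOneHom, h2]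

lemma isUnit_of_diagOneHom {A : Type*} [Ring A] {n : ℕ} (h : Matrix (Fin n) (Fin n) A)
    (hu : IsUnit (diagOneHom A n h)) : IsUnit h := by
  obtain ⟨g, hg⟩ := hu
  refine ⟨⟨h, (↑g⁻¹ : Matrix (Fin (n+1)) (Fin (n+1)) A).submatrix Fin.castSucc Fin.castSucc,
    ?_, ?_⟩, rfl⟩
  · ext i j
    have := congrFun (congrFun g.mul_inv i.castSucc) j.castSucc
    rw [hg, Matrix.mul_apply, Fin.sum_univ_castSucc] at this
    simpa [diagOneHom_cc, diagOneHom_cl, Matrix.mul_apply, Matrix.one_apply] using this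
  · ext i j
    have := congrFun (congrFun g.inv_mul i.castSucc) j.castSucc
    rw [hg, Matrix.mul_apply, Fin.sum_univ_castSucc] at this
    simpa [diagOneHom_cc, diagOneHom_lc, Matrix.mul_apply, Matrix.one_apply] using this

/-- upper left block -/
def ulBlock {A : Type*} {n : ℕ} (M : Matrix (Fin (n + 1)) (Fin (n + 1)) A) :
    Matrix (Fin n) (Fin n) A := M.submatrix Fin.castSucc Fin.castSucc

lemma ulBlock_diagOneHom {A : Type*} [Ring A] {n : ℕ} (h : Matrix (Fin n) (Fin n) A) :
    ulBlock (diagOneHom A n h) = h := by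
  ext i j; exact diagOneHom_cc h i j

lemma continuous_ulBlock (A : Type*) [TopologicalSpace A] (n : ℕ) :
    Continuous (ulBlock : Matrix (Fin (n + 1)) (Fin (n + 1)) A → _) :=
  continuous_id.matrix_submatrix _ _

/-- last row, without the last entry -/
def llRow {A : Type*} [Ring A] {n : ℕ} (M : Matrix (Fin (n + 1)) (Fin (n + 1)) A) :
    Fin (n + 1) → A := fun j => if j = Fin.last n then 0 else M (Fin.last n) j

lemma decomp {A : Type*} [Ring A] {n : ℕ} (M : Matrix (Fin (n + 1)) (Fin (n + 1)) A)
    (hM : ∀ i, M i (Fin.last n) = eL A n i) :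
    M = diagOneHom A n (ulBlock M) * tv (eL A n) (llRow M) := by
  ext i j
  rw [tv, mul_add, mul_one, Matrix.add_apply, Matrix.mul_apply, Fin.sum_univ_castSucc]
  have hne : ∀ i : Fin n, i.castSucc ≠ Fin.last n := fun i => Fin.castSucc_ne_last i
  induction i using Fin.lastCases with
  | last =>
    induction j using Fin.lastCases with
    | last => simp [diagOneHom_ll, diagOneHom_lc, Matrix.vecMulVec_apply, llRow, hM, eL]
    | cast j => simp [diagOneHom_ll, diagOneHom_lc, Matrix.vecMulVec_apply, llRow, eL, hne]
  | cast i =>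
    induction j using Fin.lastCases with
    | last => simp [diagOneHom_cl, diagOneHom_cc, Matrix.vecMulVec_apply, llRow, hM, eL, hne]
    | cast j => simp [diagOneHom_cl, diagOneHom_cc, Matrix.vecMulVec_apply, llRow, eL, hne, ulBlock]

lemma isUnit_tv_eL {A : Type*} [Ring A] {n : ℕ} (r : Fin (n + 1) → A) (hr : r (Fin.last n) = 0) :
    IsUnit (tv (eL A n) r) := by
  apply isUnit_tv
  simp [eL, hr]

lemma isUnit_ulBlock {A : Type*} [Ring A] {n : ℕ} (M : Matrix (Fin (n + 1)) (Fin (n + 1)) A)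
    (hM : ∀ i, M i (Fin.last n) = eL A n i) (hu : IsUnit M) : IsUnit (ulBlock M) := by
  apply isUnit_of_diagOneHom
  obtain ⟨g, hg⟩ := isUnit_tv_eL (llRow M) (by simp [llRow])
  have h := decomp M hM
  rw [← hg] at h
  rw [h] at hu
  simpa using hu

lemma diagOneHom_last {A : Type*} [Ring A] {n : ℕ} (h : Matrix (Fin n) (Fin n) A)
    (i : Fin (n + 1)) : diagOneHom A n h i (Fin.last n) = eL A n i := by
  induction i using Fin.lastCases with
  | last => simp [diagOneHom_ll, eL]
  | cast i => simp [diagOneHom_cl, eL, Fin.castSucc_ne_last]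

lemma pik_surjective (A : Type*) [NormedRing A] [NormedAlgebra ℝ A] [CompleteSpace A] (k n : ℕ)
    (hn : 1 ≤ n) (h : SRk C(Fin k → unitInterval, A) n) :
    Function.Surjective (piMap (Fin k)
          (⟨glSucc A n, continuous_glSucc A n⟩ : C(GLn A n, GLn A (n + 1)))
          (glSucc_one A n)) := by
  intro q
  induction q using Quotient.inductionOn with
  | _ f =>
  have hfY : ∀ y ∈ Cube.boundary (Fin k), (f.1 y).1 = 1 := fun y hy =>
    congrArg Subtype.val (f.2 y hy)
  have hone : ∀ i, (1 : Matrix (Fin (n+1)) (Fin (n+1)) A) i (Fin.last n) = eL A n i := by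
    intro i; simp [Matrix.one_apply, eL]
  obtain ⟨E, hEc, hEu, hE0, hEY, hE1⟩ := key_top hn h (Cube.boundary (Fin k))
    (fun x => (f.1 x).1) (by fun_prop) (fun x => (f.1 x).2)
    (fun y hy i => by rw [hfY y hy, hone])
  set M : (Fin k → unitInterval) → Matrix (Fin (n+1)) (Fin (n+1)) A :=
    fun x => E (1, x) * (f.1 x).1 with hM
  have hMc : Continuous M :=
    (hEc.comp (by fun_prop)).matrix_mul (by fun_prop)
  have hMu : ∀ x, IsUnit (M x) := fun x => (hEu _).mul (f.1 x).2
  have hMY : ∀ y ∈ Cube.boundary (Fin k), M y = 1 := fun y hy => by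
    simp only [hM, hEY 1 y hy, hfY y hy, mul_one]
  have hul1 : ulBlock (1 : Matrix (Fin (n+1)) (Fin (n+1)) A) = 1 := by
    rw [← map_one (diagOneHom A n), ulBlock_diagOneHom]
  let p : GenLoop (Fin k) (GLn A n) ⟨1, isUnit_one⟩ :=
    ⟨⟨fun x => ⟨ulBlock (M x), isUnit_ulBlock _ (hE1 x) (hMu x)⟩,
      ((continuous_ulBlock A n).comp hMc).subtype_mk _⟩, fun y hy => by
        apply Subtype.ext
        change ulBlock (M y) = 1
        rw [hMY y hy, hul1]⟩
  refine ⟨Quotient.mk _ p, ?_⟩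
  refine Quotient.sound ?_
  -- the intermediate map
  let m : C(Fin k → unitInterval, GLn A (n+1)) := ⟨fun x => ⟨M x, hMu x⟩, hMc.subtype_mk _⟩
  have hllc : Continuous fun x => llRow (M x) := by
    refine continuous_pi fun j => ?_
    unfold llRow
    split_ifs
    · exact continuous_const
    · exact hMc.matrix_elem _ _
  have H1 : ContinuousMap.HomotopicRel (((⟨glSucc A n, continuous_glSucc A n⟩ :
      C(GLn A n, GLn A (n + 1)))).comp p.1) m (Cube.boundary (Fin k)) := by
    refine ⟨⟨⟨⟨fun z => ⟨diagOneHom A n (ulBlock (M z.2)) *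
      tv (eL A n) (fun j => (z.1 : ℝ) • llRow (M z.2) j), ?_⟩, ?_⟩, ?_, ?_⟩, ?_⟩⟩
    · refine IsUnit.mul ((isUnit_ulBlock _ (hE1 z.2) (hMu z.2)).map _) ?_
      exact isUnit_tv_eL _ (by simp [llRow])
    · refine Continuous.subtype_mk (Continuous.matrix_mul ?_ (continuous_tv ?_ ?_)) _
      · exact (continuous_diagOneHom A n).comp
          ((continuous_ulBlock A n).comp (hMc.comp continuous_snd))
      · exact continuous_const
      · refine continuous_pi fun j => ?_
        have : Continuous fun z : unitInterval × (Fin k → unitInterval) => llRow (M z.2) j :=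
          (continuous_apply j).comp (hllc.comp continuous_snd)
        exact Continuous.smul (by fun_prop) this
    · intro x
      apply Subtype.ext
      change _ * _ = diagOneHom A n (ulBlock (M x))
      have : tv (eL A n) (fun j => (((0 : unitInterval), x).1 : ℝ) • llRow (M x) j) = 1 := by
        ext i j
        simp [tv, Matrix.vecMulVec_apply]
      rw [this, mul_one]
    · intro x
      apply Subtype.ext
      change _ * _ = M x
      have h1 : (fun j => (((1 : unitInterval), x).1 : ℝ) • llRow (M x) j) = llRow (M x) := by
        ext j; simp
      rw [h1]
      exact (decomp _ (hE1 x)).symm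
    · intro t x hx
      apply Subtype.ext
      change diagOneHom A n (ulBlock (M x)) * tv (eL A n) (fun j => (t : ℝ) • llRow (M x) j) =
        diagOneHom A n (ulBlock (M x))
      have : tv (eL A n) (fun j => (t : ℝ) • llRow (M x) j) = 1 := by
        rw [hMY x hx]
        ext i j
        simp only [tv, Matrix.vecMulVec_apply, Matrix.add_apply, llRow]
        split_ifs with hj
        · simp
        · simp [Matrix.one_apply_ne (Ne.symm hj)]
      rw [this, mul_one]
  have H2 : ContinuousMap.HomotopicRel f.1 m (Cube.boundary (Fin k)) := by
    refine ⟨⟨⟨⟨fun z => ⟨E z * (f.1 z.2).1, (hEu z).mul (f.1 z.2).2⟩, ?_⟩, ?_, ?_⟩, ?_⟩⟩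
    · refine Continuous.subtype_mk (hEc.matrix_mul ?_) _
      fun_prop
    · intro x
      apply Subtype.ext
      change E (0, x) * (f.1 x).1 = _
      rw [hE0, one_mul]
    · intro x
      rfl
    · intro t x hx
      apply Subtype.ext
      change E (t, x) * (f.1 x).1 = (f.1 x).1
      rw [hEY t x hx, one_mul]
  exact H1.trans H2.symm

lemma pik_injective (A : Type*) [NormedRing A] [NormedAlgebra ℝ A] [CompleteSpace A] (k n : ℕ)
    (hn : 1 ≤ n) (h : SRk C(unitInterval × (Fin k → unitInterval), A) n) :
    Function.Injective (piMap (Fin k)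
          (⟨glSucc A n, continuous_glSucc A n⟩ : C(GLn A n, GLn A (n + 1)))
          (glSucc_one A n)) := by
  intro q q'
  induction q using Quotient.inductionOn with
  | _ p =>
  induction q' using Quotient.inductionOn with
  | _ p' =>
  intro hpp
  obtain ⟨H⟩ : ContinuousMap.HomotopicRel (((⟨glSucc A n, continuous_glSucc A n⟩ :
      C(GLn A n, GLn A (n + 1)))).comp p.1) (((⟨glSucc A n, continuous_glSucc A n⟩ :
      C(GLn A n, GLn A (n + 1)))).comp p'.1) (Cube.boundary (Fin k)) := Quotient.exact hpp
  refine Quotient.sound ?_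
  have H0 : ∀ x, (H (0, x)).1 = diagOneHom A n (p.1 x).1 := fun x =>
    congrArg Subtype.val (H.apply_zero x)
  have H1 : ∀ x, (H (1, x)).1 = diagOneHom A n (p'.1 x).1 := fun x =>
    congrArg Subtype.val (H.apply_one x)
  have HY : ∀ t, ∀ x ∈ Cube.boundary (Fin k), (H (t, x)).1 = diagOneHom A n (p.1 x).1 :=
    fun t x hx => congrArg Subtype.val (H.prop t x hx)
  have hHc : Continuous fun z => (H z).1 := continuous_subtype_val.comp H.continuous
  obtain ⟨E, hEc, hEu, hE0, hEY, hE1⟩ := key_top hn h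
    {z | z.1 = 0 ∨ z.1 = 1 ∨ z.2 ∈ Cube.boundary (Fin k)}
    (fun z => (H z).1) hHc (fun z => (H z).2)
    (by
      rintro ⟨t, x⟩ (rfl | rfl | hx) i
      · rw [H0, diagOneHom_last]
      · rw [H1, diagOneHom_last]
      · rw [HY t x hx, diagOneHom_last])
  set M : unitInterval × (Fin k → unitInterval) → Matrix (Fin (n+1)) (Fin (n+1)) A :=
    fun z => E (1, z) * (H z).1 with hM
  have hMc : Continuous M :=
    (hEc.comp (by fun_prop)).matrix_mul hHc
  have hMu : ∀ z, IsUnit (M z) := fun z => (hEu _).mul (H z).2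
  refine ⟨⟨⟨⟨fun z => ⟨ulBlock (M z), isUnit_ulBlock _ (hE1 z) (hMu z)⟩,
      ((continuous_ulBlock A n).comp hMc).subtype_mk _⟩, ?_, ?_⟩, ?_⟩⟩
  · intro x
    apply Subtype.ext
    change ulBlock (E (1, (0, x)) * (H (0, x)).1) = (p.1 x).1
    rw [hEY 1 (0, x) (Or.inl rfl), one_mul, H0, ulBlock_diagOneHom]
  · intro x
    apply Subtype.ext
    change ulBlock (E (1, (1, x)) * (H (1, x)).1) = (p'.1 x).1
    rw [hEY 1 (1, x) (Or.inr (Or.inl rfl)), one_mul, H1, ulBlock_diagOneHom]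
  · intro t x hx
    apply Subtype.ext
    change ulBlock (E (1, (t, x)) * (H (t, x)).1) = (p.1 x).1
    rw [hEY 1 (t, x) (Or.inr (Or.inr hx)), one_mul, HY t x hx, ulBlock_diagOneHom]

/-- (Corach–Larotonda) For a unital complex Banach algebra `A` and `k ≥ 0`, the map
`π_k(GL_n(A)) → π_k(GL_{n+1}(A))` induced by `g ↦ diag(g, 1)` (based at the identity) is
surjective for every `n ≥ bsr A + k` and injective for every `n ≥ bsr A + k + 1`. -/
theorem corach_larotonda_pik_stabilization (A : Type*)
    [NormedRing A] [NormedAlgebra ℂ A] [CompleteSpace A] (k : ℕ) :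
    ∀ n : ℕ,
      (bsr A + (k : ℕ∞) ≤ (n : ℕ∞) →
        Function.Surjective (piMap (Fin k)
          (⟨glSucc A n, continuous_glSucc A n⟩ : C(GLn A n, GLn A (n + 1)))
          (glSucc_one A n))) ∧
      (bsr A + (k : ℕ∞) + 1 ≤ (n : ℕ∞) →
        Function.Injective (piMap (Fin k)
          (⟨glSucc A n, continuous_glSucc A n⟩ : C(GLn A n, GLn A (n + 1)))
          (glSucc_one A n))) := by
  intro n
  refine ⟨fun hb => ?_, fun hb => ?_⟩
  · obtain ⟨m, hm1, hm, hmn⟩ := exists_SRk_of_bsr hb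
    exact pik_surjective A k n (by omega) ((hm.cube hm1 k).mono hmn)
  · have hb' : bsr A + ((k + 1 : ℕ) : ℕ∞) ≤ (n : ℕ∞) := by
      push_cast
      rw [← add_assoc]; exact hb
    obtain ⟨m, hm1, hm, hmn⟩ := exists_SRk_of_bsr hb'
    exact pik_injective A k n (by omega)
      (((hm.cube hm1 k).prod (by omega)).mono (by omega))
end

section
/- (Rieffel) Let A be a unital complex Banach algebra. The map π₀(GL_n(A)) → π₀(GL_{n+1}(A)) induced by the embedding g ↦ diag(g,1) is bijective for every n ≥ tsr A. -/
/-- The topological stable rank: the least `n ≥ 1` such that `Lg_n(A)` is dense in `Aⁿ`. -/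
noncomputable def tsr (A : Type*) [Ring A] [TopologicalSpace A] : ℕ∞ :=
  sInf {c : ℕ∞ | ∃ n : ℕ, c = n ∧ 1 ≤ n ∧ Dense (Lg A n)}

/-- The map induced on path components by a continuous map. -/
def pi0Map {X Y : Type*} [TopologicalSpace X] [TopologicalSpace Y] {f : X → Y}
    (hf : Continuous f) : ZerothHomotopy X → ZerothHomotopy Y :=
  Quotient.map f (fun _ _ h => Nonempty.map (fun p => p.map hf) h)

open Matrix Topology

section nrm
attribute [local instance] Matrix.linftyOpNormedRing Matrix.linftyOpNormedAlgebra

lemma aux_summable (B : Type*) [NormedRing B] [CompleteSpace B] (m : ℕ) :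
    HasSummableGeomSeries (Matrix (Fin m) (Fin m) B) := by
  have h : @CompleteSpace (Matrix (Fin m) (Fin m) B)
      (Matrix.linftyOpNormedRing).toMetricSpace.toPseudoMetricSpace.toUniformSpace :=
    inferInstanceAs (CompleteSpace (Fin m → Fin m → B))
  infer_instance

/-- Small perturbations of the identity matrix are invertible, uniformly along segments. -/
lemma aux_unit_nhds (B : Type*) [NormedRing B] [NormedAlgebra ℝ B] [CompleteSpace B] (m : ℕ) :
    ∃ U ∈ 𝓝 (0 : Matrix (Fin m) (Fin m) B), ∀ M ∈ U, ∀ s : ℝ, 0 ≤ s → s ≤ 1 →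
      IsUnit (1 + s • M) := by
  have := aux_summable B m
  refine ⟨Metric.ball 0 1, Metric.ball_mem_nhds _ one_pos, ?_⟩
  intro M hM s h0 h1
  have hM' : ‖M‖ < 1 := by simpa using hM
  have : ‖-(s • M)‖ < 1 := by
    rw [norm_neg, norm_smul, Real.norm_eq_abs, abs_of_nonneg h0]
    nlinarith [norm_nonneg M]
  simpa using isUnit_one_sub_of_norm_lt_one this

/-- A path of invertible matrices has a continuous inverse. -/
lemma aux_inv_path (B : Type*) [NormedRing B] [CompleteSpace B] (m : ℕ)
    {X : Type*} [TopologicalSpace X] (g : X → Matrix (Fin m) (Fin m) B)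
    (hg : Continuous g) (hu : ∀ x, IsUnit (g x)) :
    ∃ k : X → Matrix (Fin m) (Fin m) B, Continuous k ∧ ∀ x, k x * g x = 1 ∧ g x * k x = 1 := by
  have := aux_summable B m
  refine ⟨fun x => Ring.inverse (g x), ?_, fun x => ⟨Ring.inverse_mul_cancel _ (hu x),
    Ring.mul_inverse_cancel _ (hu x)⟩⟩
  rw [continuous_iff_continuousAt]
  intro x
  obtain ⟨u, hux⟩ := hu x
  have := NormedRing.inverse_continuousAt u
  rw [hux] at this
  exact ContinuousAt.comp (f := g) (g := Ring.inverse) this hg.continuousAt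

end nrm

/-- `F` is an invertible matrix connected to the identity by invertible matrices. -/
def ConnOne {B : Type*} [Ring B] [TopologicalSpace B] {m : ℕ}
    (F : Matrix (Fin m) (Fin m) B) : Prop :=
  JoinedIn {M : Matrix (Fin m) (Fin m) B | IsUnit M} 1 F

lemma ConnOne.isUnit {B : Type*} [Ring B] [TopologicalSpace B] {m : ℕ}
    {F : Matrix (Fin m) (Fin m) B} (h : ConnOne F) : IsUnit F := h.target_mem

lemma aux_joinedIn_mul {B : Type*} [Ring B] [TopologicalSpace B] [IsTopologicalRing B] {m : ℕ}
    {F G M : Matrix (Fin m) (Fin m) B}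
    (h : JoinedIn {M : Matrix (Fin m) (Fin m) B | IsUnit M} F G) (hM : IsUnit M) :
    JoinedIn {M : Matrix (Fin m) (Fin m) B | IsUnit M} (F * M) (G * M) := by
  obtain ⟨p, hp⟩ := h
  exact ⟨p.map (f := fun N => N * M) (by fun_prop), fun t => (hp t).mul hM⟩

lemma aux_joinedIn_mul_left {B : Type*} [Ring B] [TopologicalSpace B] [IsTopologicalRing B]
    {m : ℕ} {F G M : Matrix (Fin m) (Fin m) B}
    (h : JoinedIn {M : Matrix (Fin m) (Fin m) B | IsUnit M} F G) (hM : IsUnit M) :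
    JoinedIn {M : Matrix (Fin m) (Fin m) B | IsUnit M} (M * F) (M * G) := by
  obtain ⟨p, hp⟩ := h
  exact ⟨p.map (f := fun N => M * N) (by fun_prop), fun t => hM.mul (hp t)⟩

lemma ConnOne.mul {B : Type*} [Ring B] [TopologicalSpace B] [IsTopologicalRing B] {m : ℕ}
    {F G : Matrix (Fin m) (Fin m) B} (hF : ConnOne F) (hG : ConnOne G) : ConnOne (F * G) := by
  have := aux_joinedIn_mul hF hG.isUnit
  rw [one_mul] at this
  exact JoinedIn.trans hG this

/-- A segment of invertible matrices. -/
lemma aux_connOne_segment {B : Type*} [NormedRing B] [NormedAlgebra ℝ B] {m : ℕ}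
    (N : Matrix (Fin m) (Fin m) B)
    (h : ∀ s : ℝ, 0 ≤ s → s ≤ 1 → IsUnit (1 + s • N)) : ConnOne (1 + N) := by
  refine ⟨⟨⟨fun t => 1 + (t : ℝ) • N, by fun_prop⟩, by simp, by simp⟩, ?_⟩
  intro t
  exact h t t.2.1 t.2.2

lemma aux_mulVec {B : Type*} [Ring B] {m : ℕ} (v y c : Fin m → B) :
    (1 + vecMulVec v y) *ᵥ c = fun i => c i + v i * (y ⬝ᵥ c) := by
  rw [add_mulVec, one_mulVec, vecMulVec_mulVec]
  ext i; simp

/-- Elementary transformations. -/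
lemma aux_elem {B : Type*} [NormedRing B] [NormedAlgebra ℝ B] {m : ℕ}
    (v y : Fin m → B) (h : y ⬝ᵥ v = 0) : ConnOne (1 + vecMulVec v y) := by
  apply aux_connOne_segment
  intro s _ _
  have h2 : vecMulVec v y * vecMulVec v y = 0 := by
    rw [vecMulVec_mul_vecMulVec, h]; simp
  refine ⟨⟨1 + s • vecMulVec v y, 1 - s • vecMulVec v y, ?_, ?_⟩, rfl⟩
  · rw [add_mul, mul_sub, mul_sub, smul_mul_smul_comm, h2]; simp
  · rw [sub_mul, mul_add, mul_add, smul_mul_smul_comm, h2]; simp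

/-- Nearby unimodular columns are related by an invertible matrix near one. -/
lemma aux_perturb {B : Type*} [NormedRing B] [NormedAlgebra ℝ B] [CompleteSpace B] {m : ℕ}
    (c : Fin m → B) (hc : c ∈ Lg B m) :
    ∀ᶠ c' in 𝓝 c, ∃ F : Matrix (Fin m) (Fin m) B, ConnOne F ∧ F *ᵥ c = c' := by
  obtain ⟨x, hx⟩ := hc
  obtain ⟨U, hU, hU'⟩ := aux_unit_nhds B m
  have hcont : Continuous fun c' : Fin m → B => vecMulVec (c' - c) x :=
    Continuous.matrix_vecMulVec (by fun_prop) continuous_const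
  have : Filter.Tendsto (fun c' : Fin m → B => vecMulVec (c' - c) x) (𝓝 c) (𝓝 0) := by
    have := hcont.tendsto c
    simpa using this
  filter_upwards [this hU] with c' hc'
  refine ⟨1 + vecMulVec (c' - c) x, aux_connOne_segment _ (hU' _ hc'), ?_⟩
  rw [aux_mulVec]
  have : x ⬝ᵥ c = 1 := hx
  ext i; simp [this]

lemma aux_Lg_mul {B : Type*} [Ring B] {m : ℕ} (c : Fin m → B) (hc : c ∈ Lg B m)
    (F : Matrix (Fin m) (Fin m) B) (hF : IsUnit F) : F *ᵥ c ∈ Lg B m := by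
  obtain ⟨x, hx⟩ := hc
  obtain ⟨u, rfl⟩ := hF
  refine ⟨x ᵥ* (↑u⁻¹ : Matrix (Fin m) (Fin m) B), ?_⟩
  change (x ᵥ* (↑u⁻¹ : Matrix (Fin m) (Fin m) B)) ⬝ᵥ ((u : Matrix (Fin m) (Fin m) B) *ᵥ c) = 1
  rw [dotProduct_mulVec, vecMul_vecMul]
  rw [Units.inv_mul, vecMul_one]
  exact hx

/-- Using density of `Lg A n`, all coordinates but `j` may be made unimodular. -/
lemma aux_dense {A : Type*} [Ring A] [TopologicalSpace A] {n : ℕ} (hd : Dense (Lg A n))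
    (a : Fin (n + 1) → A) (j : Fin (n + 1)) (U : Set (Fin (n + 1) → A)) (hU : U ∈ 𝓝 a) :
    ∃ a' ∈ U, a' j = a j ∧ ∃ x : Fin (n + 1) → A, x j = 0 ∧ x ⬝ᵥ a' = 1 := by
  have hcont : Continuous fun b : Fin n → A => (j.insertNth (a j) b : Fin (n + 1) → A) := by
    fun_prop
  have h1 : (fun b : Fin n → A => (j.insertNth (a j) b : Fin (n + 1) → A)) ⁻¹' U ∈
      𝓝 (fun i => a (j.succAbove i)) := by
    apply hcont.continuousAt
    convert hU
    exact Fin.insertNth_self_removeNth j a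
  obtain ⟨b, ⟨y, hy⟩, hbU⟩ := hd.inter_nhds_nonempty h1
  refine ⟨j.insertNth (a j) b, hbU, by simp, j.insertNth 0 y, by simp, ?_⟩
  rw [dotProduct, Fin.sum_univ_succAbove _ j]
  simpa using hy

/-- Unimodular columns over `A` of length `n + 1` can be moved to the last basis vector. -/
lemma aux_csr {A : Type*} [NormedRing A] [NormedAlgebra ℝ A] [CompleteSpace A] {n : ℕ}
    (hd : Dense (Lg A n)) (c : Fin (n + 1) → A) (hc : c ∈ Lg A (n + 1)) :
    ∃ F : Matrix (Fin (n + 1)) (Fin (n + 1)) A, ConnOne F ∧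
      F *ᵥ c = Pi.single (Fin.last n) 1 := by
  obtain ⟨a, ⟨F, hF, hFc⟩, -, x, hx0, hx⟩ := aux_dense hd c (Fin.last n) _ (aux_perturb c hc)
  set e : Fin (n + 1) → A := Pi.single (Fin.last n) 1 with he
  set y : Fin (n + 1) → A := (1 - a (Fin.last n)) • x with hy
  have hE1 : ConnOne (1 + vecMulVec e y) := by
    apply aux_elem
    simp [he, hy, hx0]
  set a' := (1 + vecMulVec e y) *ᵥ a with ha'
  have ha'l : a' (Fin.last n) = 1 := by
    rw [ha', aux_mulVec, hy, smul_dotProduct, hx]; simp [he]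
  have hE2 : ConnOne (1 + vecMulVec (e - a') e) := by
    apply aux_elem
    simp [he, ha'l]
  refine ⟨(1 + vecMulVec (e - a') e) * ((1 + vecMulVec e y) * F), hE2.mul (hE1.mul hF), ?_⟩
  rw [← mulVec_mulVec, ← mulVec_mulVec, hFc, ← ha', aux_mulVec]
  have : e ⬝ᵥ a' = 1 := by simp [he, ha'l]
  ext i; simp [this]

open Polynomial in
/-- Euclidean algorithm: a unimodular column of polynomials is the first column
of an invertible matrix. -/
lemma aux_euclid {A B : Type*} [NormedRing A] [NormedAlgebra ℝ A] [CompleteSpace A]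
    [NormedRing B] [NormedAlgebra ℝ B] [CompleteSpace B] {n : ℕ}
    (hd : Dense (Lg A n)) (Φ : A[X] →+* B) (hΦ : Continuous fun a => Φ (C a))
    (ev : B →+* A) (hev : ∀ a, ev (Φ (C a)) = a) (m : ℕ) :
    ∀ (D : Fin (n + 1) → ℕ), ∑ i, D i = m → ∀ P : Fin (n + 1) → A[X],
      (∀ i, (P i).natDegree ≤ D i) → (fun i => Φ (P i)) ∈ Lg B (n + 1) →
      ∃ F : Matrix (Fin (n + 1)) (Fin (n + 1)) B, IsUnit F ∧
        F *ᵥ (fun i => Φ (P i)) = Pi.single (Fin.last n) 1 := by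
  induction m with
  | zero =>
    intro D hD P hP hL
    have hP0 : ∀ i, P i = C ((P i).coeff 0) := by
      intro i
      apply eq_C_of_natDegree_le_zero
      have : D i = 0 := by
        simpa using (Finset.sum_eq_zero_iff.mp hD) i (Finset.mem_univ i)
      exact this ▸ hP i
    have hLA : (fun i => (P i).coeff 0) ∈ Lg A (n + 1) := by
      obtain ⟨x, hx⟩ := hL
      refine ⟨fun i => ev (x i), ?_⟩
      have := congrArg ev hx
      rw [map_sum, map_one] at this
      rw [← this]
      refine Finset.sum_congr rfl fun i _ => ?_
      have h2 : ev (Φ (P i)) = (P i).coeff 0 := by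
        conv_lhs => rw [hP0 i]
        exact hev _
      rw [map_mul]
      exact congrArg _ h2.symm
    obtain ⟨F, hF, hFc⟩ := aux_csr hd _ hLA
    refine ⟨(Φ.comp C).mapMatrix F, hF.isUnit.map _, ?_⟩
    ext i
    have := RingHom.map_mulVec (Φ.comp C) F (fun i => (P i).coeff 0) i
    rw [hFc] at this
    have h2 : (⇑(Φ.comp C) ∘ fun i => (P i).coeff 0) = fun i => Φ (P i) := by
      ext i
      simp only [Function.comp, RingHom.comp_apply]
      rw [← hP0 i]
    rw [h2] at this
    rw [RingHom.mapMatrix_apply, ← this]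
    by_cases h : i = Fin.last n
    · subst h; simp
    · simp [h]
  | succ m ih =>
    intro D hD P hP hL
    obtain ⟨j, hj⟩ := Finite.exists_max D
    have hjpos : 0 < D j := by
      by_contra h
      have h0 : D j = 0 := by omega
      have : ∑ i, D i = 0 := Finset.sum_eq_zero fun i _ => by have := hj i; omega
      omega
    -- perturb leading coefficients
    let Q : (Fin (n + 1) → A) → Fin (n + 1) → A[X] :=
      fun a i => P i + C (a i - (P i).coeff (D i)) * X ^ (D i)
    have hQc : Continuous fun a => (fun i => Φ (Q a i)) := by
      refine continuous_pi fun i => ?_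
      simp only [Q, map_add, map_mul]
      refine continuous_const.add (Continuous.mul ?_ continuous_const)
      exact hΦ.comp (by fun_prop)
    set a0 : Fin (n + 1) → A := fun i => (P i).coeff (D i) with ha0
    have hQ0 : (fun i => Φ (Q a0 i)) = fun i => Φ (P i) := by
      ext i; simp [Q, a0]
    have hnb : {a | ∃ F : Matrix (Fin (n + 1)) (Fin (n + 1)) B, ConnOne F ∧
        F *ᵥ (fun i => Φ (P i)) = fun i => Φ (Q a i)} ∈ 𝓝 a0 := by
      have h1 := hQc.tendsto a0
      rw [hQ0] at h1
      exact h1 (aux_perturb _ hL)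
    obtain ⟨a, ⟨F, hF, hFc⟩, haj, x, hxj, hx⟩ := aux_dense hd a0 j _ hnb
    have hQdeg : ∀ i, (Q a i).natDegree ≤ D i := by
      intro i
      refine natDegree_add_le_of_degree_le (hP i) (natDegree_C_mul_X_pow_le _ _)
    have hQcoeff : ∀ i, (Q a i).coeff (D i) = a i := by
      intro i
      simp only [Q, coeff_add, coeff_C_mul, coeff_X_pow_self]
      simp
    -- the row operation
    let y : Fin (n + 1) → A[X] := fun i => - (C (a j * x i) * X ^ (D j - D i))
    have hyj : y j = 0 := by simp [y, hxj]
    let R : Fin (n + 1) → A[X] := fun i => Q a i + (Pi.single j 1 : Fin (n + 1) → A[X]) i * (y ⬝ᵥ Q a)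
    let E : Matrix (Fin (n + 1)) (Fin (n + 1)) B :=
      1 + vecMulVec (Pi.single j 1) (fun i => Φ (y i))
    have hE : ConnOne E := by
      apply aux_elem
      simp [hyj]
    have hEc : E *ᵥ (fun i => Φ (Q a i)) = fun i => Φ (R i) := by
      simp only [E]
      rw [aux_mulVec]
      ext i
      simp only [R, map_add, map_mul]
      congr 2
      · by_cases h : i = j
        · subst h; simp
        · simp [h]
      · simp [dotProduct, map_sum]
    have hRdeg : ∀ i, (R i).natDegree ≤ Function.update D j (D j - 1) i := by
      intro i
      by_cases h : i = j
      · subst h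
        have hle : (R i).natDegree ≤ D i := by
          simp only [R]
          refine natDegree_add_le_of_degree_le (hQdeg i) ?_
          rw [Pi.single_eq_same, one_mul]
          refine natDegree_sum_le_of_forall_le _ _ fun k _ => ?_
          simp only [y, neg_mul, natDegree_neg, mul_assoc]
          refine (natDegree_C_mul_le _ _).trans ?_
          refine natDegree_mul_le.trans ?_
          have h1 := natDegree_X_pow_le (R := A) (D i - D k)
          have h2 := hQdeg k
          have h3 := hj k
          omega
        have hc0 : (R i).coeff (D i) = 0 := by
          simp only [R, Pi.single_eq_same, one_mul, coeff_add, dotProduct, finsetSum_coeff,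
            hQcoeff]
          have : ∀ k, (y k * Q a k).coeff (D i) = - (a i * (x k * a k)) := by
            intro k
            simp only [y, neg_mul, coeff_neg, mul_assoc, coeff_C_mul, coeff_X_pow_mul']
            have h3 := hj k
            rw [if_pos (by omega), show D i - (D i - D k) = D k by omega, hQcoeff]
          rw [Finset.sum_congr rfl fun k _ => this k, Finset.sum_neg_distrib, ← Finset.mul_sum]
          have hx' : ∑ k, x k * a k = 1 := hx
          rw [hx']; simp
        rw [Function.update_self]
        by_contra hlt
        have heq : (R i).natDegree = D i := by omega
        rw [← heq] at hc0
        have := leadingCoeff_eq_zero.mp hc0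
        rw [this] at heq
        simp at heq; omega
      · rw [Function.update_of_ne h]
        simp only [R]
        rw [Pi.single_eq_of_ne h]
        simpa using hQdeg i
    have hsum : ∑ i, Function.update D j (D j - 1) i = m := by
      rw [Finset.sum_update_of_mem (Finset.mem_univ j)]
      have := Finset.add_sum_erase Finset.univ D (Finset.mem_univ j)
      rw [Finset.sdiff_singleton_eq_erase]
      omega
    have hRF : (fun i => Φ (R i)) = (E * F) *ᵥ (fun i => Φ (P i)) := by
      rw [← mulVec_mulVec, hFc, hEc]
    obtain ⟨G, hG, hGc⟩ := ih _ hsum R hRdeg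
      (hRF ▸ aux_Lg_mul _ hL _ (hE.isUnit.mul hF.isUnit))
    refine ⟨G * (E * F), hG.mul (hE.isUnit.mul hF.isUnit), ?_⟩
    rw [← mulVec_mulVec, ← hRF, hGc]

section circle

variable (A : Type*) [NormedRing A] [NormedAlgebra ℂ A]

/-- Constant loops. -/
def loopConst : A →+* C(UnitAddCircle, A) where
  toFun a := ContinuousMap.const _ a
  map_one' := rfl
  map_zero' := rfl
  map_mul' _ _ := rfl
  map_add' _ _ := rfl

/-- Evaluation of loops at a point. -/
def loopEval (s : UnitAddCircle) : C(UnitAddCircle, A) →+* A where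
  toFun f := f s
  map_one' := rfl
  map_zero' := rfl
  map_mul' _ _ := rfl
  map_add' _ _ := rfl

/-- The coordinate loop. -/
noncomputable def loopZ (k : ℤ) : C(UnitAddCircle, A) :=
  ⟨fun s => algebraMap ℂ A (fourier k s),
    (algebraMapCLM ℂ A).continuous.comp (fourier k).continuous⟩

lemma loopZ_comm (k : ℤ) (f : C(UnitAddCircle, A)) : Commute f (loopZ A k) := by
  ext s
  exact (Algebra.commutes _ _).symm

lemma loopZ_add (k l : ℤ) : loopZ A (k + l) = loopZ A k * loopZ A l := by
  ext s
  simp [loopZ]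

lemma loopZ_zero : loopZ A 0 = 1 := by
  ext s
  simp [loopZ]

lemma loopZ_pow (m : ℕ) : loopZ A 1 ^ m = loopZ A m := by
  induction m with
  | zero => simp [loopZ_zero]
  | succ m ih => rw [pow_succ, ih, ← loopZ_add]; simp

/-- Evaluation of polynomials at the coordinate loop. -/
noncomputable def loopPoly : Polynomial A →+* C(UnitAddCircle, A) :=
  Polynomial.eval₂RingHom' (loopConst A) (loopZ A 1) (fun _ => loopZ_comm A 1 _)

lemma loopPoly_C (a : A) : loopPoly A (Polynomial.C a) = loopConst A a := by
  simp [loopPoly, Polynomial.eval₂RingHom']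

lemma loopPoly_X : loopPoly A Polynomial.X = loopZ A 1 := by
  simp [loopPoly, Polynomial.eval₂RingHom']

lemma smul_eq_loop (r : ℂ) (f : C(UnitAddCircle, A)) :
    r • f = loopConst A (algebraMap ℂ A r) * f := by
  ext s
  exact Algebra.smul_def _ _

/-- Laurent polynomial loops. -/
noncomputable def laurentLoops : Submodule ℂ C(UnitAddCircle, A) where
  carrier := {f | ∃ K : ℕ, ∀ m ≥ K, ∃ P : Polynomial A, loopZ A m * f = loopPoly A P}
  zero_mem' := ⟨0, fun m _ => ⟨0, by simp⟩⟩
  add_mem' := by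
    rintro f g ⟨K, hf⟩ ⟨K', hg⟩
    refine ⟨max K K', fun m hm => ?_⟩
    obtain ⟨P, hP⟩ := hf m (le_trans (le_max_left _ _) hm)
    obtain ⟨Q, hQ⟩ := hg m (le_trans (le_max_right _ _) hm)
    exact ⟨P + Q, by rw [mul_add, hP, hQ, map_add]⟩
  smul_mem' := by
    rintro r f ⟨K, hf⟩
    refine ⟨K, fun m hm => ?_⟩
    obtain ⟨P, hP⟩ := hf m hm
    refine ⟨Polynomial.C (algebraMap ℂ A r) * P, ?_⟩
    rw [map_mul, ← hP, loopPoly_C, ← smul_eq_loop, mul_smul_comm]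

lemma laurent_closure_smul (φ : C(UnitAddCircle, ℂ)) (a : A) :
    (ContinuousLinearMap.toSpanSingleton ℂ a).compLeftContinuous ℂ UnitAddCircle φ ∈
      (laurentLoops A).topologicalClosure := by
  set T := (ContinuousLinearMap.toSpanSingleton ℂ a).compLeftContinuous ℂ UnitAddCircle with hT
  have h1 : (Submodule.span ℂ (Set.range (fourier (T := (1 : ℝ))))) ≤
      (laurentLoops A).comap (T : C(UnitAddCircle, ℂ) →ₗ[ℂ] C(UnitAddCircle, A)) := by
    rw [Submodule.span_le]
    rintro _ ⟨k, rfl⟩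
    refine ⟨k.natAbs, fun m hm => ?_⟩
    refine ⟨Polynomial.C a * Polynomial.X ^ (k + m).toNat, ?_⟩
    rw [map_mul, map_pow, loopPoly_C, loopPoly_X, loopZ_pow, Int.toNat_of_nonneg (by omega),
      add_comm k, loopZ_add]
    ext s
    change algebraMap ℂ A (fourier m s) * (fourier k s • a) =
      a * (algebraMap ℂ A (fourier m s) * algebraMap ℂ A (fourier k s))
    rw [Algebra.smul_def, Algebra.commutes (fourier k s) a, ← mul_assoc, ← mul_assoc,
      Algebra.commutes _ a]
  have h2 : φ ∈ (Submodule.span ℂ (Set.range (fourier (T := (1 : ℝ))))).topologicalClosure := by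
    rw [span_fourier_closure_eq_top]; trivial
  exact map_mem_closure T.continuous h2 fun x hx => h1 hx

lemma laurent_dense : Dense (laurentLoops A : Set C(UnitAddCircle, A)) := by
  intro f
  have hcl : closure (laurentLoops A : Set C(UnitAddCircle, A)) =
    ((laurentLoops A).topologicalClosure : Set C(UnitAddCircle, A)) := rfl
  rw [← closure_closure, hcl, Metric.mem_closure_iff]
  intro ε hε
  let U : UnitAddCircle → Set UnitAddCircle := fun x => {y | ‖f y - f x‖ < ε / 2}
  have hUo : ∀ x, IsOpen (U x) := fun x => isOpen_lt (by fun_prop) continuous_const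
  obtain ⟨t, ht⟩ := CompactSpace.elim_nhds_subcover U
    (fun x => (hUo x).mem_nhds (by simp [U, hε]))
  obtain ⟨ρ, hρ⟩ := PartitionOfUnity.exists_isSubordinate (s := Set.univ) isClosed_univ
    (fun i : t => U i) (fun i => hUo i) (by
      intro y _
      have : y ∈ ⋃ x ∈ t, U x := by rw [ht]; trivial
      simpa using this)
  let g : C(UnitAddCircle, A) := ∑ i : t,
    (ContinuousLinearMap.toSpanSingleton ℂ (f i)).compLeftContinuous ℂ UnitAddCircle
      ⟨fun s => ((ρ i s : ℝ) : ℂ), by fun_prop⟩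
  refine ⟨g, Submodule.sum_mem _ fun i _ => laurent_closure_smul A _ _, ?_⟩
  rw [dist_eq_norm]
  refine lt_of_le_of_lt ((ContinuousMap.norm_le _ (by positivity : 0 ≤ ε / 2)).mpr ?_)
    (half_lt_self hε)
  intro s
  have hsum : ∑ i, ρ i s = 1 := by
    rw [← finsum_eq_sum_of_fintype]; exact ρ.sum_eq_one (Set.mem_univ s)
  have hg : g s = ∑ i : t, ((ρ i s : ℝ) : ℂ) • f i := by
    simp only [g, ContinuousMap.sum_apply]; rfl
  have hf : f s = ∑ i : t, ((ρ i s : ℝ) : ℂ) • f s := by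
    rw [← Finset.sum_smul, ← Complex.ofReal_sum, hsum]; simp
  rw [ContinuousMap.sub_apply, hg]
  conv_lhs => rw [hf]
  rw [← Finset.sum_sub_distrib]
  calc _ ≤ ∑ i : t, ρ i s * (ε / 2) := by
        refine norm_sum_le_of_le _ fun i _ => ?_
        rw [← smul_sub, norm_smul, Complex.norm_real, Real.norm_eq_abs,
          abs_of_nonneg (ρ.nonneg i s)]
        by_cases h : ρ i s = 0
        · simp [h]
        · have : s ∈ U i := hρ i (subset_tsupport _ h)
          exact mul_le_mul_of_nonneg_left (le_of_lt this) (ρ.nonneg i s)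
    _ = ε / 2 := by rw [← Finset.sum_mul, hsum, one_mul]

end circle

/-- Unimodular loops of columns are last columns of loops of invertible matrices. -/
lemma aux_loop_frame (A : Type*) [NormedRing A] [NormedAlgebra ℂ A] [CompleteSpace A] {n : ℕ}
    (hd : Dense (Lg A n)) (c : Fin (n + 1) → C(UnitAddCircle, A))
    (hc : c ∈ Lg C(UnitAddCircle, A) (n + 1)) :
    ∃ F : Matrix (Fin (n + 1)) (Fin (n + 1)) C(UnitAddCircle, A), IsUnit F ∧
        F *ᵥ c = Pi.single (Fin.last n) 1 := by
  let _ : NormedAlgebra ℝ A := NormedAlgebra.restrictScalars ℝ ℂ A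
  have hdense : Dense (Set.univ.pi fun _ : Fin (n + 1) =>
      (laurentLoops A : Set C(UnitAddCircle, A))) :=
    dense_pi _ fun _ _ => laurent_dense A
  obtain ⟨c', hc'L, F, hF, hFc⟩ := hdense.inter_nhds_nonempty (aux_perturb c hc)
  have hc' : ∀ i, ∃ K : ℕ, ∀ m ≥ K, ∃ P : Polynomial A, loopZ A m * c' i = loopPoly A P :=
    fun i => hc'L i trivial
  choose K hK using hc'
  set M := ∑ i, K i
  choose P hP using fun i => hK i M (Finset.single_le_sum (f := K) (fun _ _ => Nat.zero_le _)
    (Finset.mem_univ i))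
  have hzu : IsUnit (loopZ A (M : ℤ)) :=
    ⟨⟨loopZ A M, loopZ A (-M), by rw [← loopZ_add]; simp [loopZ_zero],
      by rw [← loopZ_add]; simp [loopZ_zero]⟩, rfl⟩
  have hSu : IsUnit (Matrix.scalar (Fin (n + 1)) (loopZ A (M : ℤ))) := hzu.map _
  have hSc : Matrix.scalar (Fin (n + 1)) (loopZ A (M : ℤ)) *ᵥ c' = fun i => loopPoly A (P i) := by
    ext1 i
    rw [Matrix.scalar_apply, mulVec_diagonal, hP]
  have hPL : (fun i => loopPoly A (P i)) ∈ Lg C(UnitAddCircle, A) (n + 1) := by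
    rw [← hSc, ← hFc]
    exact aux_Lg_mul _ (aux_Lg_mul _ hc _ hF.isUnit) _ hSu
  obtain ⟨G, hG, hGc⟩ := aux_euclid hd (loopPoly A)
    (by
      simp only [loopPoly_C]
      exact ContinuousMap.continuous_const')
    (loopEval A 0)
    (by intro a; rw [loopPoly_C]; rfl) _ (fun i => (P i).natDegree) rfl P (fun _ => le_rfl) hPL
  refine ⟨G * (Matrix.scalar (Fin (n + 1)) (loopZ A (M : ℤ)) * F),
    hG.mul (hSu.mul hF.isUnit), ?_⟩
  rw [← mulVec_mulVec, ← mulVec_mulVec, hFc, hSc, hGc]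

/-- A closed path defines a loop on the circle. -/
lemma aux_lift {A : Type*} [TopologicalSpace A] (f : unitInterval → A) (hf : Continuous f)
    (h : f 0 = f 1) : ∃ g : C(UnitAddCircle, A), ∀ t : unitInterval, g ((t : ℝ)) = f t := by
  let F : ℝ → A := Set.IccExtend zero_le_one f
  have hF : Continuous F := hf.Icc_extend'
  have h01 : F 0 = F 1 := by
    simp only [F]
    rw [Set.IccExtend_left, Set.IccExtend_right]
    exact h
  refine ⟨⟨AddCircle.liftIco 1 0 F, AddCircle.liftIco_zero_continuous h01 hF.continuousOn⟩, ?_⟩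
  intro t
  change AddCircle.liftIco 1 0 F _ = _
  by_cases ht : (t : ℝ) < 1
  · rw [AddCircle.liftIco_zero_coe_apply ⟨t.2.1, ht⟩]
    exact Set.IccExtend_of_mem _ _ t.2
  · have h1 : (t : ℝ) = 1 := le_antisymm t.2.2 (not_lt.mp ht)
    have h2 : t = 1 := Subtype.ext h1
    rw [h1, AddCircle.coe_period, ← AddCircle.coe_zero,
      AddCircle.liftIco_zero_coe_apply ⟨le_rfl, one_pos⟩, h01, h2]
    exact Set.IccExtend_right _ _

section block

variable {A : Type*} [Ring A] {n : ℕ}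

lemma diag_cc (M : Matrix (Fin n) (Fin n) A) (i j : Fin n) :
    diagOneHom A n M i.castSucc j.castSucc = M i j := by
  change Matrix.fromBlocks M 0 0 (1 : Matrix (Fin 1) (Fin 1) A)
    (finSumFinEquiv.symm (Fin.castAdd 1 i)) (finSumFinEquiv.symm (Fin.castAdd 1 j)) = _
  simp

lemma diag_cl (M : Matrix (Fin n) (Fin n) A) (i : Fin n) :
    diagOneHom A n M i.castSucc (Fin.last n) = 0 := by
  change Matrix.fromBlocks M 0 0 (1 : Matrix (Fin 1) (Fin 1) A)
    (finSumFinEquiv.symm (Fin.castAdd 1 i)) (finSumFinEquiv.symm (Fin.natAdd n 0)) = _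
  simp

lemma diag_lc (M : Matrix (Fin n) (Fin n) A) (i : Fin n) :
    diagOneHom A n M (Fin.last n) i.castSucc = 0 := by
  change Matrix.fromBlocks M 0 0 (1 : Matrix (Fin 1) (Fin 1) A)
    (finSumFinEquiv.symm (Fin.natAdd n 0)) (finSumFinEquiv.symm (Fin.castAdd 1 i)) = _
  simp

lemma diag_ll (M : Matrix (Fin n) (Fin n) A) :
    diagOneHom A n M (Fin.last n) (Fin.last n) = 1 := by
  change Matrix.fromBlocks M 0 0 (1 : Matrix (Fin 1) (Fin 1) A)
    (finSumFinEquiv.symm (Fin.natAdd n 0)) (finSumFinEquiv.symm (Fin.natAdd n 0)) = _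
  simp

/-- The top left block. -/
def tl (M : Matrix (Fin (n + 1)) (Fin (n + 1)) A) : Matrix (Fin n) (Fin n) A :=
  M.submatrix Fin.castSucc Fin.castSucc

/-- The last basis vector. -/
def eLast (A : Type*) [Ring A] (n : ℕ) : Fin (n + 1) → A := Pi.single (Fin.last n) 1

lemma mulVec_eLast (M : Matrix (Fin (n + 1)) (Fin (n + 1)) A) (i : Fin (n + 1)) :
    (M *ᵥ eLast A n) i = M i (Fin.last n) := by
  simp [eLast]

lemma tl_diag (M : Matrix (Fin n) (Fin n) A) : tl (diagOneHom A n M) = M := by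
  ext i j; exact diag_cc M i j

lemma diag_eLast (M : Matrix (Fin n) (Fin n) A) :
    diagOneHom A n M *ᵥ eLast A n = eLast A n := by
  ext i
  rw [mulVec_eLast]
  refine Fin.lastCases ?_ (fun i => ?_) i
  · rw [diag_ll]; simp [eLast]
  · rw [diag_cl, eLast, Pi.single_eq_of_ne (Fin.castSucc_lt_last i).ne]

lemma col_zero {M : Matrix (Fin (n + 1)) (Fin (n + 1)) A} (hM : M *ᵥ eLast A n = eLast A n)
    (i : Fin n) : M i.castSucc (Fin.last n) = 0 := by
  rw [← mulVec_eLast M, hM, eLast, Pi.single_eq_of_ne (Fin.castSucc_lt_last i).ne]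

lemma tl_mul {M : Matrix (Fin (n + 1)) (Fin (n + 1)) A} (hM : M *ᵥ eLast A n = eLast A n)
    (N : Matrix (Fin (n + 1)) (Fin (n + 1)) A) : tl (M * N) = tl M * tl N := by
  ext i j
  simp only [tl, Matrix.submatrix_apply, Matrix.mul_apply, Fin.sum_univ_castSucc, col_zero hM]
  simp

lemma tl_one : tl (1 : Matrix (Fin (n + 1)) (Fin (n + 1)) A) = 1 := by
  ext i j
  simp [tl, Matrix.one_apply]

lemma tl_isUnit {M : Matrix (Fin (n + 1)) (Fin (n + 1)) A} (hu : IsUnit M)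
    (hM : M *ᵥ eLast A n = eLast A n) : IsUnit (tl M) := by
  obtain ⟨u, rfl⟩ := hu
  have hN : (↑u⁻¹ : Matrix (Fin (n + 1)) (Fin (n + 1)) A) *ᵥ eLast A n = eLast A n := by
    conv_lhs => rw [← hM]
    rw [mulVec_mulVec, Units.inv_mul, one_mulVec]
  refine ⟨⟨tl u, tl (↑u⁻¹ : Matrix (Fin (n + 1)) (Fin (n + 1)) A), ?_, ?_⟩, rfl⟩
  · rw [← tl_mul hM, Units.mul_inv, tl_one]
  · rw [← tl_mul hN, Units.inv_mul, tl_one]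

end block

lemma aux_inj (A : Type*) [NormedRing A] [NormedAlgebra ℂ A] [CompleteSpace A] {n : ℕ}
    (hd : Dense (Lg A n)) (g₀ g₁ : Matrix (Fin n) (Fin n) A)
    (h : JoinedIn {M | IsUnit M} (diagOneHom A n g₀) (diagOneHom A n g₁)) :
    JoinedIn {M | IsUnit M} g₀ g₁ := by
  obtain ⟨γ, hγ⟩ := h
  have hγ0 : γ 0 = diagOneHom A n g₀ := γ.source
  have hγ1 : γ 1 = diagOneHom A n g₁ := γ.target
  obtain ⟨k, hk, hkγ⟩ := aux_inv_path A (n + 1) γ γ.continuous hγ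
  have hent : ∀ t i, γ t i (Fin.last n) = (γ t *ᵥ eLast A n) i := fun t i =>
    (mulVec_eLast _ _).symm
  -- the last row of the inverse, at the end points
  have hrow : ∀ (t : unitInterval) (g : Matrix (Fin n) (Fin n) A), γ t = diagOneHom A n g →
      ∀ i, k t (Fin.last n) i = eLast A n i := by
    intro t g hg i
    have h1 : eLast A n ᵥ* γ t = eLast A n := by
      ext i
      rw [hg]
      have : (eLast A n ᵥ* diagOneHom A n g) i = diagOneHom A n g (Fin.last n) i := by
        simp [eLast]
      rw [this]
      refine Fin.lastCases ?_ (fun i => ?_) i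
      · rw [diag_ll]; simp [eLast]
      · rw [diag_lc, eLast, Pi.single_eq_of_ne (Fin.castSucc_lt_last i).ne]
    have h2 : eLast A n ᵥ* k t = eLast A n := by
      conv_lhs => rw [← h1]
      rw [vecMul_vecMul, (hkγ t).2, vecMul_one]
    have h3 := congrFun h2 i
    rw [← h3]
    simp [eLast]
  choose c hc using fun i => aux_lift (fun t => γ t i (Fin.last n))
    (γ.continuous.matrix_elem i (Fin.last n))
    (by rw [hent, hent, hγ0, hγ1, diag_eLast, diag_eLast])
  choose x hx using fun i => aux_lift (fun t => k t (Fin.last n) i)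
    (hk.matrix_elem (Fin.last n) i)
    (by rw [hrow 0 g₀ hγ0, hrow 1 g₁ hγ1])
  have hcL : c ∈ Lg C(UnitAddCircle, A) (n + 1) := by
    refine ⟨x, ?_⟩
    ext s
    obtain ⟨t, rfl⟩ : ∃ t : unitInterval, ((t : ℝ) : UnitAddCircle) = s := by
      obtain ⟨r, hr, rfl⟩ := (AddCircle.coe_image_Ico_eq (1 : ℝ) 0).ge (Set.mem_univ s)
      exact ⟨⟨r, hr.1, by have := hr.2; linarith⟩, rfl⟩
    rw [ContinuousMap.sum_apply]
    simp only [ContinuousMap.mul_apply, hx, hc]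
    have := congrFun (congrFun (hkγ t).1 (Fin.last n)) (Fin.last n)
    rw [Matrix.mul_apply] at this
    rw [this]; simp
  obtain ⟨F, hF, hFc⟩ := aux_loop_frame A hd c hcL
  let Fs : UnitAddCircle → Matrix (Fin (n + 1)) (Fin (n + 1)) A :=
    fun s => (loopEval A s).mapMatrix F
  have hFsu : ∀ s, IsUnit (Fs s) := fun s => hF.map _
  have hFsc : Continuous Fs := by
    refine continuous_pi fun i => continuous_pi fun j => ?_
    exact (F i j).continuous
  have hFse : ∀ t : unitInterval, Fs (t : ℝ) *ᵥ (γ t *ᵥ eLast A n) = eLast A n := by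
    intro t
    ext i
    have h1 := RingHom.map_mulVec (loopEval A ((t : ℝ) : UnitAddCircle)) F c i
    rw [hFc] at h1
    have h2 : (⇑(loopEval A ((t : ℝ) : UnitAddCircle)) ∘ c) = γ t *ᵥ eLast A n := by
      ext i
      rw [mulVec_eLast]
      exact hc i t
    rw [h2] at h1
    refine h1.symm.trans ?_
    by_cases hi : i = Fin.last n
    · subst hi; simp [eLast]
    · simp [eLast, hi]
  set K := Fs ((0 : ℝ) : UnitAddCircle) with hK
  have hK1 : Fs ((1 : ℝ) : UnitAddCircle) = K := by
    rw [hK, AddCircle.coe_period, AddCircle.coe_zero]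
  have hKe : K *ᵥ eLast A n = eLast A n := by
    have := hFse 0
    rw [hγ0, diag_eLast] at this
    exact this
  have hku : IsUnit (tl K) := tl_isUnit (hFsu _) hKe
  have hpath : JoinedIn {M : Matrix (Fin n) (Fin n) A | IsUnit M} (tl K * g₀) (tl K * g₁) := by
    refine ⟨⟨⟨fun t => tl (Fs (t : ℝ) * γ t), ?_⟩, ?_, ?_⟩, ?_⟩
    · have h1 : Continuous fun t : unitInterval => Fs ((t : ℝ) : UnitAddCircle) * γ t :=
        (hFsc.comp ((AddCircle.continuous_mk' 1).comp continuous_subtype_val)).mul γ.continuous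
      exact h1.matrix_submatrix _ _
    · change tl (K * γ 0) = _
      rw [tl_mul hKe, hγ0, tl_diag]
    · change tl (Fs ((1 : ℝ) : UnitAddCircle) * γ 1) = _
      rw [hK1, tl_mul hKe, hγ1, tl_diag]
    · intro t
      refine tl_isUnit ((hFsu _).mul (hγ t)) ?_
      rw [← mulVec_mulVec]
      exact hFse t
  obtain ⟨u, hu⟩ := hku
  have := aux_joinedIn_mul_left hpath (M := (↑u⁻¹ : Matrix (Fin n) (Fin n) A)) u⁻¹.isUnit
  rwa [← hu, ← mul_assoc, ← mul_assoc, Units.inv_mul, one_mul, one_mul] at this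

lemma aux_surj (A : Type*) [NormedRing A] [NormedAlgebra ℂ A] [CompleteSpace A] {n : ℕ}
    (hd : Dense (Lg A n)) (g : Matrix (Fin (n + 1)) (Fin (n + 1)) A) (hg : IsUnit g) :
    ∃ h : Matrix (Fin n) (Fin n) A, IsUnit h ∧
      JoinedIn {M | IsUnit M} (diagOneHom A n h) g := by
  let _ : NormedAlgebra ℝ A := NormedAlgebra.restrictScalars ℝ ℂ A
  have he : eLast A n ∈ Lg A (n + 1) := by
    refine ⟨eLast A n, ?_⟩
    change eLast A n ⬝ᵥ eLast A n = 1
    simp [eLast]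
  obtain ⟨F, hF, hFc⟩ := aux_csr hd (g *ᵥ eLast A n) (aux_Lg_mul _ he _ hg)
  have hM : (F * g) *ᵥ eLast A n = eLast A n := by rw [← mulVec_mulVec, hFc]; rfl
  have hMu : IsUnit (F * g) := hF.isUnit.mul hg
  have hhu : IsUnit (tl (F * g)) := tl_isUnit hMu hM
  refine ⟨tl (F * g), hhu, ?_⟩
  have hJ1 : JoinedIn {M : Matrix (Fin (n + 1)) (Fin (n + 1)) A | IsUnit M} g (F * g) := by
    have := aux_joinedIn_mul hF hg
    rwa [one_mul] at this
  set M := F * g with hMdef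
  let r : Fin (n + 1) → A := fun i => M (Fin.last n) i - eLast A n i
  have hE : ConnOne (1 + vecMulVec (eLast A n) r) := by
    apply aux_elem
    have h1 : r ⬝ᵥ eLast A n = r (Fin.last n) := by simp [eLast]
    rw [h1]
    simp only [r]
    rw [← mulVec_eLast M, hM, sub_self]
  have hdM : diagOneHom A n (tl M) * (1 + vecMulVec (eLast A n) r) = M := by
    rw [mul_add, mul_one, mul_vecMulVec, diag_eLast]
    ext i j
    refine Fin.lastCases ?_ (fun i => ?_) i
    · refine Fin.lastCases ?_ (fun j => ?_) j
      · simp [diag_ll, vecMulVec_apply, eLast, r]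
      · simp [diag_lc, vecMulVec_apply, eLast, r, (Fin.castSucc_lt_last j).ne]
    · refine Fin.lastCases ?_ (fun j => ?_) j
      · simp [diag_cl, vecMulVec_apply, eLast, (Fin.castSucc_lt_last i).ne, col_zero hM]
      · simp [diag_cc, vecMulVec_apply, eLast, (Fin.castSucc_lt_last i).ne, tl]
  have hJ2 := aux_joinedIn_mul_left hE (hhu.map (diagOneHom A n))
  rw [hdM, mul_one] at hJ2
  exact hJ2.trans hJ1.symm

lemma aux_dense_succ (A : Type*) [NormedRing A] {n : ℕ} (hd : Dense (Lg A n)) :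
    Dense (Lg A (n + 1)) := by
  intro a
  rw [mem_closure_iff_nhds]
  intro U hU
  obtain ⟨a', ha', -, x, -, hx⟩ := aux_dense hd a 0 U hU
  exact ⟨a', ha', x, hx⟩

lemma aux_dense_of_tsr (A : Type*) [NormedRing A] {n : ℕ} (h : tsr A ≤ (n : ℕ∞)) :
    Dense (Lg A n) := by
  have hne : {c : ℕ∞ | ∃ n : ℕ, c = n ∧ 1 ≤ n ∧ Dense (Lg A n)}.Nonempty := by
    by_contra hemp
    rw [Set.not_nonempty_iff_eq_empty] at hemp
    rw [tsr, hemp, sInf_empty] at h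
    exact absurd h (by simp)
  obtain ⟨m, hm, -, hmd⟩ := csInf_mem hne
  have hmn : m ≤ n := by
    rw [tsr, hm] at h
    exact_mod_cast h
  clear hm h
  induction n, hmn using Nat.le_induction with
  | base => exact hmd
  | succ k _ ih => exact aux_dense_succ A ih

lemma joined_iff_joinedIn (A : Type*) [NormedRing A] {n : ℕ} (x y : GLn A n) :
    Joined x y ↔ JoinedIn {M | IsUnit M} x.1 y.1 :=
  (joinedIn_iff_joined (F := {M : Matrix (Fin n) (Fin n) A | IsUnit M}) x.2 y.2).symm

/-- (Rieffel) For a unital complex Banach algebra `A`, the map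
`π₀(GL_n(A)) → π₀(GL_{n+1}(A))` induced by `g ↦ diag(g, 1)` is bijective for every
`n ≥ tsr A`. -/
theorem rieffel_pi0_bijective_of_tsr (A : Type*)
    [NormedRing A] [NormedAlgebra ℂ A] [CompleteSpace A] :
    ∀ n : ℕ, tsr A ≤ (n : ℕ∞) →
      Function.Bijective (pi0Map (continuous_glSucc A n)) := by
  intro n hn
  have hd := aux_dense_of_tsr A hn
  constructor
  · intro a b
    induction a using Quotient.inductionOn with | _ a => ?_
    induction b using Quotient.inductionOn with | _ b => ?_
    intro h
    have h1 : Joined (glSucc A n a) (glSucc A n b) := Quotient.exact h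
    apply Quotient.sound
    exact (joined_iff_joinedIn A a b).mpr
      (aux_inj A hd a.1 b.1 ((joined_iff_joinedIn A _ _).mp h1))
  · intro b
    induction b using Quotient.inductionOn with | _ b => ?_
    obtain ⟨h, hu, hj⟩ := aux_surj A hd b.1 b.2
    refine ⟨Quotient.mk _ ⟨h, hu⟩, ?_⟩
    apply Quotient.sound
    exact (joined_iff_joinedIn A (glSucc A n ⟨h, hu⟩) b).mpr hj
end
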